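/- Fix input size p ≥ 3, a measurable space Z = ℝ^{p×p} × {0,1} with probability measure D, and N ≥ 1. Let f be the Gabor filter generator function, i.e. f(θ,σ,γ,λ,ψ) is the 3×3 matrix (g_{θ,σ,γ,λ,ψ}(x,y))_{x,y∈{−1,0,1}}. For a network F let ℓ_F(I, y) = (F̃(I) − y)² ∈ [0,1] be its loss function, and let L be the (countable, e.g. rational-weight) class of loss functions of common CNNs with a fixed architecture. Fix δ ∈ (0,1). Then with probability at least 1 − δ over S = ((I₁,y₁), …, (I_N,y_N)) drawn i.i.d. from D, for every common CNN F in the class and every ε > 0, there exist d* ∈ ℕ and a well-defined GO-CNN G with Gabor generator f and first-fully-connected-layer width d₁ ≥ d* such that E_{(I,y)∼D}[ℓ_G(I,y)] ≤ Ê_S[F] + 2·Ř_S(L) + √(log(1/δ)/(2N)) + ε. (Corollary 2) -/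

import Mathlib

open MeasureTheory

/-- The Gabor filter function `g_{θ,σ,γ,λ,ψ}(x, y)`. -/
noncomputable def gabor (θ σ γ lam ψ : ℝ) (x y : ℝ) : ℝ :=
  let x' : ℝ := x * Real.cos θ + y * Real.sin θ
  let y' : ℝ := -x * Real.sin θ + y * Real.cos θ
  Real.exp (-(x' ^ 2 + γ ^ 2 * y' ^ 2) / (2 * σ ^ 2)) *
    Real.cos (2 * Real.pi * x' / lam + ψ)

/-- Coordinate of a `Fin 3` index in `{-1, 0, 1}`. -/
def coord (i : Fin 3) : ℝ := (i : ℝ) - 1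

/-- The 3×3 Gabor kernel with parameters `(θ, σ, γ, λ, ψ)` (the Gabor generator
function). -/
noncomputable def gaborKernel (θ σ γ lam ψ : ℝ) : Matrix (Fin 3) (Fin 3) ℝ :=
  fun x y => gabor θ σ γ lam ψ (coord x) (coord y)

/-- Valid 2D discrete convolution of an input `I : ℝ^{p×q}` with a kernel `k : ℝ^{m×m}`. -/
noncomputable def conv2d (p q m : ℕ) (hp : m ≤ p) (hq : m ≤ q)
    (k : Matrix (Fin m) (Fin m) ℝ) (I : Matrix (Fin p) (Fin q) ℝ) :
    Matrix (Fin (p - m + 1)) (Fin (q - m + 1)) ℝ :=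
  fun i j => ∑ s : Fin m, ∑ t : Fin m,
    I ⟨i.val + s.val, by have h1 := i.isLt; have h2 := s.isLt; omega⟩
      ⟨j.val + t.val, by have h1 := j.isLt; have h2 := t.isLt; omega⟩ * k s t

/-- The sigmoid activation `σ(t) = 1 / (1 + e^{-t})`. -/
noncomputable def sigmoid (t : ℝ) : ℝ := 1 / (1 + Real.exp (-t))

/-- Pre-activation output of a CNN with one convolutional layer (with `d₀` kernels of
size 3×3) followed by two fully-connected layers with sigmoid activations. -/
noncomputable def cnnOut {p d₀ d₁ : ℕ} (hp : 3 ≤ p)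
    (ker : Fin d₀ → Matrix (Fin 3) (Fin 3) ℝ)
    (b₀ : Fin d₀ × Fin (p - 3 + 1) × Fin (p - 3 + 1) → ℝ)
    (A₁ : Matrix (Fin d₁) (Fin d₀ × Fin (p - 3 + 1) × Fin (p - 3 + 1)) ℝ)
    (b₁ : Fin d₁ → ℝ) (a₂ : Fin d₁ → ℝ) (b₂ : ℝ)
    (x : Matrix (Fin p) (Fin p) ℝ) : ℝ :=
  let feat : Fin d₀ × Fin (p - 3 + 1) × Fin (p - 3 + 1) → ℝ :=
    fun q => conv2d p p 3 hp hp (ker q.1) x q.2.1 q.2.2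
  let h₀ : Fin d₀ × Fin (p - 3 + 1) × Fin (p - 3 + 1) → ℝ :=
    fun q => sigmoid (feat q + b₀ q)
  let h₁ : Fin d₁ → ℝ := fun i => sigmoid (A₁.mulVec h₀ i + b₁ i)
  (∑ i : Fin d₁, a₂ i * h₁ i) + b₂

/-- Loss function `ℓ_F(I, y) = (F̃(I) - y)²` of a network on a labelled example,
with labels in `{0, 1}` encoded by `Bool`. -/
noncomputable def cnnLoss {p d₀ d₁ : ℕ} (hp : 3 ≤ p)
    (ker : Fin d₀ → Matrix (Fin 3) (Fin 3) ℝ)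
    (b₀ : Fin d₀ × Fin (p - 3 + 1) × Fin (p - 3 + 1) → ℝ)
    (A₁ : Matrix (Fin d₁) (Fin d₀ × Fin (p - 3 + 1) × Fin (p - 3 + 1)) ℝ)
    (b₁ : Fin d₁ → ℝ) (a₂ : Fin d₁ → ℝ) (b₂ : ℝ)
    (z : Matrix (Fin p) (Fin p) ℝ × Bool) : ℝ :=
  (sigmoid (cnnOut hp ker b₀ A₁ b₁ a₂ b₂ z.1) - (if z.2 then (1 : ℝ) else 0)) ^ 2

/-- Empirical Rademacher complexity of a class `H` of real-valued functions on `Z`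
with respect to the sample `S = (z₁, …, z_N)`. -/
noncomputable def empRad {Z : Type*} {N : ℕ} (S : Fin N → Z) (H : Set (Z → ℝ)) : ℝ :=
  (2 ^ N : ℝ)⁻¹ * ∑ ε : Fin N → Bool,
    sSup ((fun h : Z → ℝ =>
      (N : ℝ)⁻¹ * ∑ i : Fin N, (if ε i then (1 : ℝ) else -1) * h (S i)) '' H)

/-- A matrix of reals carries the product measurable structure. -/
instance matrixMeasurableSpace {p q : ℕ} :
    MeasurableSpace (Matrix (Fin p) (Fin q) ℝ) := by
  unfold Matrix; infer_instance

set_option maxHeartbeats 1600000 in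
theorem gg_poly (a b : ℝ) (ha0 : 0 ≤ a) (ha1 : a ≤ 1) (hb0 : 0 ≤ b) (hb1 : b ≤ 1)
    (u w y1 y2 : ℝ) (hu : u = 3 / 2 * a) (hw : w = b / 4)
    (hy1 : y1 = u / 8 + u * w - u ^ 2 * w / 2) (hy2 : y2 = u / 4 + 2 * u * w - u ^ 2 * w / 3) :
    u * w ≤ ((1 + u ^ 2 / 18) * (1 - u / 8) - (1 - y1 + y1 ^ 2 / 2)) *
      ((1 + y2 + y2 ^ 2 / 2) + u ^ 2 / 18) := by
  have h1 : 0 ≤ 1 - a := by linarith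
  have h2 : 0 ≤ 1 - b := by linarith
  have key : ((1 + u ^ 2 / 18) * (1 - u / 8) - (1 - y1 + y1 ^ 2 / 2)) *
      ((1 + y2 + y2 ^ 2 / 2) + u ^ 2 / 18) - u * w = u ^ 2 * (
      55/1152*(a^0*(1-a)^6)*(b^0*(1-b)^4) +
      7/72*(a^0*(1-a)^6)*(b^1*(1-b)^3) +
      19/192*(a^0*(1-a)^6)*(b^2*(1-b)^2) +
      7/72*(a^0*(1-a)^6)*(b^3*(1-b)^1) +
      55/1152*(a^0*(1-a)^6)*(b^4*(1-b)^0) +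
      301/1024*(a^1*(1-a)^5)*(b^0*(1-b)^4) +
      331/512*(a^1*(1-a)^5)*(b^1*(1-b)^3) +
      43/64*(a^1*(1-a)^5)*(b^2*(1-b)^2) +
      309/512*(a^1*(1-a)^5)*(b^3*(1-b)^1) +
      291/1024*(a^1*(1-a)^5)*(b^4*(1-b)^0) +
      111919/147456*(a^2*(1-a)^4)*(b^0*(1-b)^4) +
      65275/36864*(a^2*(1-a)^4)*(b^1*(1-b)^3) +
      44995/24576*(a^2*(1-a)^4)*(b^2*(1-b)^2) +
      54103/36864*(a^2*(1-a)^4)*(b^3*(1-b)^1) +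
      94327/147456*(a^2*(1-a)^4)*(b^4*(1-b)^0) +
      9671/9216*(a^3*(1-a)^3)*(b^0*(1-b)^4) +
      94169/36864*(a^3*(1-a)^3)*(b^1*(1-b)^3) +
      7921/3072*(a^3*(1-a)^3)*(b^2*(1-b)^2) +
      66707/36864*(a^3*(1-a)^3)*(b^3*(1-b)^1) +
      6623/9216*(a^3*(1-a)^3)*(b^4*(1-b)^0) +
      20089/24576*(a^4*(1-a)^2)*(b^0*(1-b)^4) +
      6287/3072*(a^4*(1-a)^2)*(b^1*(1-b)^3) +
      65013/32768*(a^4*(1-a)^2)*(b^2*(1-b)^2) +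
      58259/49152*(a^4*(1-a)^2)*(b^3*(1-b)^1) +
      41119/98304*(a^4*(1-a)^2)*(b^4*(1-b)^0) +
      6257/18432*(a^5*(1-a)^1)*(b^0*(1-b)^4) +
      31825/36864*(a^5*(1-a)^1)*(b^1*(1-b)^3) +
      19423/24576*(a^5*(1-a)^1)*(b^2*(1-b)^2) +
      55963/147456*(a^5*(1-a)^1)*(b^3*(1-b)^1) +
      16183/147456*(a^5*(1-a)^1)*(b^4*(1-b)^0) +
      2881/49152*(a^6*(1-a)^0)*(b^0*(1-b)^4) +
      1841/12288*(a^6*(1-a)^0)*(b^1*(1-b)^3) +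
      4155/32768*(a^6*(1-a)^0)*(b^2*(1-b)^2) +
      1043/24576*(a^6*(1-a)^0)*(b^3*(1-b)^1) +
      5141/786432*(a^6*(1-a)^0)*(b^4*(1-b)^0)) := by
    subst hy1 hy2 hu hw
    ring
  rw [← sub_nonneg, key]
  positivity

theorem gg_sinh_le (x : ℝ) (hx : 0 ≤ x) : Real.sinh x ≤ x * Real.exp (x ^ 2 / 6) := by
  have h1 := Real.hasSum_sinh x
  have h2 : HasSum (fun n : ℕ => x * ((x ^ 2 / 6) ^ n / (n.factorial : ℝ)))
      (x * Real.exp (x ^ 2 / 6)) := by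
    rw [Real.exp_eq_exp_ℝ]
    exact (NormedSpace.expSeries_div_hasSum_exp (x ^ 2 / 6)).mul_left x
  refine hasSum_le (fun n => ?_) h1 h2
  have hf : (6 : ℝ) ^ n * n.factorial ≤ (2 * n + 1).factorial := by
    induction n with
    | zero => simp
    | succ k ih =>
      have : (2 * (k + 1) + 1).factorial = (2 * k + 3) * ((2 * k + 2) * (2 * k + 1).factorial) := by
        rw [show 2 * (k + 1) + 1 = (2 * k + 1) + 1 + 1 by ring, Nat.factorial_succ,
          Nat.factorial_succ]
      rw [this, Nat.factorial_succ]
      push_cast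
      have hk : (0 : ℝ) ≤ k := by positivity
      have h0 : (0 : ℝ) ≤ (6 : ℝ) ^ k * k.factorial := by positivity
      calc (6 : ℝ) ^ (k + 1) * ((k + 1) * k.factorial)
          = (6 * (k + 1)) * (6 ^ k * k.factorial) := by ring
        _ ≤ ((2 * k + 3) * (2 * k + 2)) * (2 * k + 1).factorial := by
            apply mul_le_mul _ ih h0 (by positivity)
            nlinarith
        _ = _ := by ring
  have e : x * ((x ^ 2 / 6) ^ n / (n.factorial : ℝ)) =
      x ^ (2 * n + 1) / ((6 : ℝ) ^ n * n.factorial) := by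
    rw [div_pow, ← pow_mul]; field_simp; ring
  rw [e]
  apply div_le_div_of_nonneg_left (by positivity) (by positivity) hf

set_option maxHeartbeats 800000 in
/-- key inequality in symmetric coordinates -/
theorem gg_key_h (u h k : ℝ) (hu0 : 0 ≤ u) (hu1 : u ≤ 3 / 2) (hh0 : 0 ≤ h) (hh1 : h ≤ 1 / 2) :
    Real.exp (-(u * (1 / 8 + h ^ 2))) * (Real.cosh (u * h) + 2 * k * Real.sinh (u * h)) ≤
      (1 + u ^ 2 / 18) * (1 - u / 8 + u * k ^ 2) := by
  set K := 1 + u ^ 2 / 18 with hK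
  have hKpos : 1 ≤ K := by rw [hK]; nlinarith [sq_nonneg u]
  set w := h ^ 2 with hw
  have hw0 : 0 ≤ w := sq_nonneg h
  have hw1 : w ≤ 1 / 4 := by rw [hw]; nlinarith
  set y1 := u / 8 + u * w - u ^ 2 * w / 2 with hy1
  set y2 := u / 4 + 2 * u * w - u ^ 2 * w / 3 with hy2
  have huw : 0 ≤ u * w := mul_nonneg hu0 hw0
  have hy1n : 0 ≤ y1 := by rw [hy1]; nlinarith
  have hy2n : 0 ≤ y2 := by rw [hy2]; nlinarith
  set E := Real.exp (-(u * (1 / 8 + w))) with hE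
  have hEpos : 0 < E := Real.exp_pos _
  have hC : E * Real.cosh (u * h) ≤ 1 - y1 + y1 ^ 2 / 2 := by
    calc E * Real.cosh (u * h) ≤ E * Real.exp ((u * h) ^ 2 / 2) :=
          mul_le_mul_of_nonneg_left (Real.cosh_le_exp_half_sq _) hEpos.le
      _ = Real.exp (-y1) := by
          rw [hE, ← Real.exp_add]; congr 1; rw [hy1, hw]; ring
      _ ≤ 1 - y1 + y1 ^ 2 / 2 := by
          have h3 := Real.quadratic_le_exp_of_nonneg hy1n
          rw [Real.exp_neg]
          rw [inv_le_comm₀ (Real.exp_pos _) (by nlinarith [sq_nonneg (y1 - 1)])]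
          refine le_trans ?_ h3
          rw [inv_le_iff_one_le_mul₀ (by nlinarith [sq_nonneg (y1 - 1)])]
          nlinarith [sq_nonneg (y1 ^ 2)]
  have hS : (E * Real.sinh (u * h)) ^ 2 * (1 + y2 + y2 ^ 2 / 2) ≤ u ^ 2 * w := by
    have hs0 : 0 ≤ Real.sinh (u * h) := Real.sinh_nonneg_iff.2 (by positivity)
    have h1 : E * Real.sinh (u * h) ≤ E * (u * h * Real.exp ((u * h) ^ 2 / 6)) :=
      mul_le_mul_of_nonneg_left (gg_sinh_le _ (by positivity)) hEpos.le
    have h2 : (E * Real.sinh (u * h)) ^ 2 ≤ (E * (u * h * Real.exp ((u * h) ^ 2 / 6))) ^ 2 :=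
      pow_le_pow_left₀ (by positivity) h1 2
    have h3 : (E * (u * h * Real.exp ((u * h) ^ 2 / 6))) ^ 2 = u ^ 2 * w * Real.exp (-y2) := by
      have : Real.exp (-y2) = (E * Real.exp ((u * h) ^ 2 / 6)) ^ 2 := by
        rw [hE, ← Real.exp_add, ← Real.exp_nat_mul]; congr 1; rw [hy2, hw]; push_cast; ring
      rw [this, hw]; ring
    have h4 := Real.quadratic_le_exp_of_nonneg hy2n
    calc (E * Real.sinh (u * h)) ^ 2 * (1 + y2 + y2 ^ 2 / 2)
        ≤ (u ^ 2 * w * Real.exp (-y2)) * Real.exp y2 := by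
          rw [← h3]
          exact mul_le_mul h2 h4 (by positivity) (by positivity)
      _ = u ^ 2 * w := by rw [mul_assoc, ← Real.exp_add]; simp
  have hp := gg_poly (2 / 3 * u) (4 * w) (by positivity) (by linarith) (by positivity)
    (by linarith) u w y1 y2 (by ring) (by ring) hy1 hy2
  rcases hu0.eq_or_lt with rfl | hupos
  · simp [hE, hK]
  set Z := 1 + y2 + y2 ^ 2 / 2 with hZ
  have hZpos : 1 ≤ Z := by rw [hZ]; nlinarith [sq_nonneg y2]
  set L := (1 + u ^ 2 / 18) * (1 - u / 8) - (1 - y1 + y1 ^ 2 / 2) with hL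
  have hL0 : 0 ≤ L := by
    by_contra hneg
    push Not at hneg
    have : L * (Z + u ^ 2 / 18) < 0 := mul_neg_of_neg_of_pos hneg (by positivity)
    linarith
  have hKZ : Z + u ^ 2 / 18 ≤ K * Z := by
    rw [hK]; nlinarith [sq_nonneg u]
  have hp2 : u * w ≤ L * (K * Z) := hp.trans (mul_le_mul_of_nonneg_left hKZ hL0)
  set s := E * Real.sinh (u * h) with hs
  have hs2 : s ^ 2 ≤ u * K * L := by
    have : s ^ 2 * Z ≤ (u * K * L) * Z := by
      calc s ^ 2 * Z ≤ u ^ 2 * w := hS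
        _ = u * (u * w) := by ring
        _ ≤ u * (L * (K * Z)) := mul_le_mul_of_nonneg_left hp2 hu0
        _ = _ := by ring
    exact le_of_mul_le_mul_right this (by linarith)
  have hfin : 2 * k * s ≤ L + K * (u * k ^ 2) := by
    have hKu : 0 < K * u := by positivity
    have : 0 ≤ (K * u) * (L + K * (u * k ^ 2) - 2 * k * s) := by
      have e0 : (K * u) * (L + K * (u * k ^ 2) - 2 * k * s) =
          (K * u * k - s) ^ 2 + (u * K * L - s ^ 2) := by ring
      rw [e0]
      exact add_nonneg (sq_nonneg _) (sub_nonneg.2 hs2)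
    have := nonneg_of_mul_nonneg_right this hKu
    linarith
  have e1 : E * (Real.cosh (u * h) + 2 * k * Real.sinh (u * h)) =
      E * Real.cosh (u * h) + 2 * k * s := by rw [hs]; ring
  rw [e1]
  have e2 : K * (1 - u / 8 + u * k ^ 2) = K * (1 - u / 8) + K * (u * k ^ 2) := by ring
  rw [e2]
  have e3 : L = K * (1 - u / 8) - (1 - y1 + y1 ^ 2 / 2) := rfl
  linarith

theorem gg_key_h' (u h k : ℝ) (hu0 : 0 ≤ u) (hu1 : u ≤ 3 / 2) (hh0 : |h| ≤ 1 / 2) :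
    Real.exp (-(u * (1 / 8 + h ^ 2))) * (Real.cosh (u * h) + 2 * k * Real.sinh (u * h)) ≤
      (1 + u ^ 2 / 18) * (1 - u / 8 + u * k ^ 2) := by
  rcases le_total 0 h with h0 | h0
  · exact gg_key_h u h k hu0 hu1 h0 (by rwa [abs_of_nonneg h0] at hh0)
  · have := gg_key_h u (-h) (-k) hu0 hu1 (by linarith) (by rwa [abs_of_nonpos h0] at hh0)
    simpa using this

theorem gg_key (u f e : ℝ) (hu0 : 0 ≤ u) (hu1 : u ≤ 3 / 2) (hf0 : 0 ≤ f) (hf1 : f ≤ 1) :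
    e * Real.exp (-(u * (f - 1) ^ 2)) + (1 - e) * Real.exp (-(u * f ^ 2)) ≤
      (1 + u ^ 2 / 18) * Real.exp (-(u / 8)) * (1 + u / 8 - u * (e * (1 - e))) := by
  have h := gg_key_h' u (f - 1 / 2) (e - 1 / 2) hu0 hu1 (abs_le.2 ⟨by linarith, by linarith⟩)
  have h2 := mul_le_mul_of_nonneg_left h (Real.exp_pos (-(u / 8))).le
  have e1 : Real.exp (-(u * (f - 1) ^ 2)) = Real.exp (-(u / 8)) *
      (Real.exp (-(u * (1 / 8 + (f - 1 / 2) ^ 2))) * Real.exp (u * (f - 1 / 2))) := by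
    rw [← Real.exp_add, ← Real.exp_add]; congr 1; ring
  have e2 : Real.exp (-(u * f ^ 2)) = Real.exp (-(u / 8)) *
      (Real.exp (-(u * (1 / 8 + (f - 1 / 2) ^ 2))) * Real.exp (-(u * (f - 1 / 2)))) := by
    rw [← Real.exp_add, ← Real.exp_add]; congr 1; ring
  rw [e1, e2]
  rw [Real.cosh_eq, Real.sinh_eq] at h2
  refine le_of_eq_of_le ?_ (h2.trans_eq ?_) <;> ring

/-- regression function -/
noncomputable def ggEta {X : Type*} [MeasurableSpace X] (D : Measure (X × Bool)) [IsFiniteMeasure D]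
    (x : X) : ℝ := (D.condKernel x).real {true}

theorem ggEta_meas {X : Type*} [MeasurableSpace X] (D : Measure (X × Bool)) [IsFiniteMeasure D] :
    Measurable (ggEta D) := by
  unfold ggEta Measure.real
  exact (ProbabilityTheory.Kernel.measurable_coe _ (MeasurableSet.singleton _)).ennreal_toReal

theorem ggEta_nonneg {X : Type*} [MeasurableSpace X] (D : Measure (X × Bool)) [IsFiniteMeasure D]
    (x : X) : 0 ≤ ggEta D x := measureReal_nonneg

theorem ggEta_le {X : Type*} [MeasurableSpace X] (D : Measure (X × Bool)) [IsFiniteMeasure D]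
    (x : X) : ggEta D x ≤ 1 := measureReal_le_one

theorem gg_int {X : Type*} [MeasurableSpace X] (D : Measure (X × Bool)) [IsFiniteMeasure D]
    (h : X × Bool → ℝ) (hh : Integrable h D) :
    ∫ z, h z ∂D = ∫ x, (ggEta D x * h (x, true) + (1 - ggEta D x) * h (x, false)) ∂D.fst := by
  rw [← Measure.integral_condKernel hh]
  apply integral_congr_ae
  refine Filter.Eventually.of_forall fun x => ?_
  simp only
  rw [integral_fintype (Integrable.of_finite)]
  have : (D.condKernel x).real {false} = 1 - ggEta D x := by
    have h1 := probReal_compl_eq_one_sub (μ := D.condKernel x) (MeasurableSet.singleton true)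
    have : ({true}ᶜ : Set Bool) = {false} := by ext b; cases b <;> simp
    rw [this] at h1
    exact h1
  simp [this, ggEta]

/-- Bayes risk -/
noncomputable def ggR {X : Type*} [MeasurableSpace X] (D : Measure (X × Bool)) [IsFiniteMeasure D] : ℝ :=
  ∫ x, ggEta D x * (1 - ggEta D x) ∂D.fst

theorem gg_bdd_int {X : Type*} [MeasurableSpace X] (μ : Measure X) [IsFiniteMeasure μ] (f : X → ℝ)
    (hf : Measurable f) (C : ℝ) (h : ∀ x, |f x| ≤ C) : Integrable f μ :=
  Integrable.of_bound (C := C) hf.aestronglyMeasurable (Filter.Eventually.of_forall h)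

theorem gg_v_int {X : Type*} [MeasurableSpace X] (D : Measure (X × Bool)) [IsProbabilityMeasure D] :
    Integrable (fun x => ggEta D x * (1 - ggEta D x)) D.fst := by
  have h1 := ggEta_meas D
  refine gg_bdd_int _ _ (by fun_prop) 1 fun x => ?_
  have h2 := ggEta_nonneg D x
  have h3 := ggEta_le D x
  rw [abs_le]; constructor <;> nlinarith

theorem ggR_nonneg {X : Type*} [MeasurableSpace X] (D : Measure (X × Bool)) [IsProbabilityMeasure D] :
    0 ≤ ggR D :=
  integral_nonneg fun x => mul_nonneg (ggEta_nonneg D x) (by linarith [ggEta_le D x])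

theorem ggR_le {X : Type*} [MeasurableSpace X] (D : Measure (X × Bool)) [IsProbabilityMeasure D] :
    ggR D ≤ 1 / 4 := by
  have : ggR D ≤ ∫ _x, (1 / 4 : ℝ) ∂D.fst := by
    apply integral_mono (gg_v_int D) (integrable_const _)
    intro x
    simp only
    nlinarith [sq_nonneg (ggEta D x - 1 / 2)]
  simpa using this

theorem gg_loss_meas {X : Type*} [MeasurableSpace X] (f : X → ℝ) (hf : Measurable f) :
    Measurable fun z : X × Bool => (f z.1 - (if z.2 then (1 : ℝ) else 0)) ^ 2 := by
  have h1 : Measurable fun z : X × Bool => (if z.2 then (1 : ℝ) else 0) :=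
    (measurable_from_top (f := fun b : Bool => if b then (1 : ℝ) else 0)).comp measurable_snd
  have h2 : Measurable fun z : X × Bool => f z.1 := hf.comp measurable_fst
  exact (h2.sub h1).pow_const 2

theorem gg_loss_bd {X : Type*} (f : X → ℝ) (h0 : ∀ x, 0 ≤ f x) (h1 : ∀ x, f x ≤ 1) (z : X × Bool) :
    0 ≤ (f z.1 - (if z.2 then (1 : ℝ) else 0)) ^ 2 ∧
    (f z.1 - (if z.2 then (1 : ℝ) else 0)) ^ 2 ≤ 1 := by
  refine ⟨sq_nonneg _, ?_⟩
  have := h0 z.1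
  have := h1 z.1
  split_ifs <;> nlinarith

theorem gg_risk {X : Type*} [MeasurableSpace X] (D : Measure (X × Bool)) [IsProbabilityMeasure D]
    (f : X → ℝ) (hf : Measurable f) (h0 : ∀ x, 0 ≤ f x) (h1 : ∀ x, f x ≤ 1) :
    ∫ z, (f z.1 - (if z.2 then (1 : ℝ) else 0)) ^ 2 ∂D =
      ggR D + ∫ x, (f x - ggEta D x) ^ 2 ∂D.fst := by
  have hm := ggEta_meas D
  rw [gg_int D _ (gg_bdd_int _ _ (gg_loss_meas f hf) 1 fun z => by
    have := gg_loss_bd f h0 h1 z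
    rw [abs_le]; constructor <;> linarith)]
  unfold ggR
  rw [← integral_add (gg_v_int D)]
  · apply integral_congr_ae
    refine Filter.Eventually.of_forall fun x => ?_
    simp
    ring
  · refine gg_bdd_int _ _ (by fun_prop) 1 fun x => ?_
    have := h0 x
    have := h1 x
    have := ggEta_nonneg D x
    have := ggEta_le D x
    rw [abs_of_nonneg (sq_nonneg _)]
    nlinarith

theorem gg_mgf {X : Type*} [MeasurableSpace X] (D : Measure (X × Bool)) [IsProbabilityMeasure D]
    (f : X → ℝ) (hf : Measurable f) (h0 : ∀ x, 0 ≤ f x) (h1 : ∀ x, f x ≤ 1) (u : ℝ)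
    (hu0 : 0 ≤ u) (hu1 : u ≤ 3 / 2) :
    ∫ z, Real.exp (-(u * ((f z.1 - (if z.2 then (1 : ℝ) else 0)) ^ 2 - ggR D))) ∂D ≤
      1 + u ^ 2 / 18 := by
  have hm := ggEta_meas D
  have hle : ∫ z, Real.exp (-(u * (f z.1 - (if z.2 then (1 : ℝ) else 0)) ^ 2)) ∂D ≤
      (1 + u ^ 2 / 18) * Real.exp (-(u * ggR D)) := by
    have hmz := gg_loss_meas f hf
    rw [gg_int D _ (gg_bdd_int _ _ (by fun_prop) 1 fun z => by
      have := gg_loss_bd f h0 h1 z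
      rw [abs_of_pos (Real.exp_pos _), Real.exp_le_one_iff]
      nlinarith)]
    have hA : ∫ x, (1 + u ^ 2 / 18) * Real.exp (-(u / 8)) *
        (1 + u / 8 - u * (ggEta D x * (1 - ggEta D x))) ∂D.fst =
        (1 + u ^ 2 / 18) * Real.exp (-(u / 8)) * (1 + u / 8 - u * ggR D) := by
      rw [integral_const_mul, integral_sub (integrable_const _) ((gg_v_int D).const_mul u),
        integral_const_mul]
      simp [ggR]
    calc _ ≤ ∫ x, (1 + u ^ 2 / 18) * Real.exp (-(u / 8)) *
        (1 + u / 8 - u * (ggEta D x * (1 - ggEta D x))) ∂D.fst := by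
          apply integral_mono
          · refine gg_bdd_int _ _ (by
              simp only [if_true, Bool.false_eq_true, if_false, sub_zero]; fun_prop) 1 fun x => ?_
            have a1 := ggEta_nonneg D x
            have a2 := ggEta_le D x
            have b1 : Real.exp (-(u * (f x - 1) ^ 2)) ≤ 1 := by
              rw [Real.exp_le_one_iff]; nlinarith [sq_nonneg (f x - 1)]
            have b2 : Real.exp (-(u * (f x) ^ 2)) ≤ 1 := by
              rw [Real.exp_le_one_iff]; nlinarith [sq_nonneg (f x)]
            have c1 := Real.exp_pos (-(u * (f x - 1) ^ 2))
            have c2 := Real.exp_pos (-(u * (f x) ^ 2))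
            simp only [if_true, Bool.false_eq_true, if_false, sub_zero]
            rw [abs_le]; constructor <;> nlinarith
          · exact (((integrable_const _).sub ((gg_v_int D).const_mul u))).const_mul _
          · intro x
            have := gg_key u (f x) (ggEta D x) hu0 hu1 (h0 x) (h1 x)
            simpa using this
      _ = _ := hA
      _ ≤ (1 + u ^ 2 / 18) * Real.exp (-(u / 8)) * Real.exp (u / 8 - u * ggR D) := by
          apply mul_le_mul_of_nonneg_left _ (by positivity)
          have := Real.add_one_le_exp (u / 8 - u * ggR D)
          linarith
      _ = _ := by
          rw [mul_assoc, ← Real.exp_add]; congr 2; ring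
  have e1 : ∀ z : X × Bool, Real.exp (-(u * ((f z.1 - (if z.2 then (1 : ℝ) else 0)) ^ 2 - ggR D))) =
      Real.exp (u * ggR D) * Real.exp (-(u * (f z.1 - (if z.2 then (1 : ℝ) else 0)) ^ 2)) := by
    intro z
    rw [← Real.exp_add]; congr 1; ring
  simp only [e1]
  rw [integral_const_mul]
  calc _ ≤ Real.exp (u * ggR D) * ((1 + u ^ 2 / 18) * Real.exp (-(u * ggR D))) :=
        mul_le_mul_of_nonneg_left hle (Real.exp_pos _).le
    _ = (1 + u ^ 2 / 18) * (Real.exp (u * ggR D) * Real.exp (-(u * ggR D))) := by ring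
    _ = 1 + u ^ 2 / 18 := by rw [← Real.exp_add]; simp

/-- the split functional -/
noncomputable def ggV {Z ι : Type*} {N : ℕ} (k : ι → Z → ℝ) (ε : Fin N → Bool) (S : Fin N → Z) : ℝ :=
  (⨆ i, ∑ j, (if ε j then (1 : ℝ) else -1) * k i (S j)) +
    ⨅ i, ∑ j, (if ε j then (0 : ℝ) else k i (S j))

theorem gg_bdd {Z ι : Type*} {N : ℕ} (k : ι → Z → ℝ) (B : ℝ)
    (hB : ∀ i z, |k i z| ≤ B) (S : Fin N → Z) (c : Fin N → ℝ) (hc : ∀ j, |c j| ≤ 1) (i : ι) :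
    |∑ j, c j * k i (S j)| ≤ N * B := by
  calc |∑ j, c j * k i (S j)| ≤ ∑ j, |c j * k i (S j)| := Finset.abs_sum_le_sum_abs _ _
    _ ≤ ∑ _j : Fin N, B := by
        apply Finset.sum_le_sum
        intro j _
        rw [abs_mul]
        have h0 := abs_nonneg (k i (S j))
        nlinarith [hc j, hB i (S j), abs_nonneg (c j)]
    _ = N * B := by simp

theorem gg_bddAbove {Z ι : Type*} {N : ℕ} (k : ι → Z → ℝ) (B : ℝ)
    (hB : ∀ i z, |k i z| ≤ B) (S : Fin N → Z) (c : Fin N → ℝ) (hc : ∀ j, |c j| ≤ 1) :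
    BddAbove (Set.range fun i => ∑ j, c j * k i (S j)) := by
  refine ⟨N * B, ?_⟩
  rintro _ ⟨i, rfl⟩
  exact (abs_le.1 (gg_bdd k B hB S c hc i)).2

theorem gg_bddBelow {Z ι : Type*} {N : ℕ} (k : ι → Z → ℝ) (B : ℝ)
    (hB : ∀ i z, |k i z| ≤ B) (S : Fin N → Z) (c : Fin N → ℝ) (hc : ∀ j, |c j| ≤ 1) :
    BddBelow (Set.range fun i => ∑ j, c j * k i (S j)) := by
  refine ⟨-(N * B), ?_⟩
  rintro _ ⟨i, rfl⟩
  exact (abs_le.1 (gg_bdd k B hB S c hc i)).1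

theorem gg_ite_mul {Z ι : Type*} {N : ℕ} (k : ι → Z → ℝ) (ε : Fin N → Bool) (S : Fin N → Z) (i : ι) :
    ∑ j, (if ε j then (0 : ℝ) else k i (S j)) =
      ∑ j, (if ε j then (0 : ℝ) else 1) * k i (S j) := by
  apply Finset.sum_congr rfl; intro j _; split_ifs <;> simp

theorem gg_c1 {N : ℕ} (ε : Fin N → Bool) (j : Fin N) : |(if ε j then (1 : ℝ) else -1)| ≤ 1 := by
  split_ifs <;> simp

theorem gg_c2 {N : ℕ} (ε : Fin N → Bool) (j : Fin N) : |(if ε j then (0 : ℝ) else 1)| ≤ 1 := by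
  split_ifs <;> simp

theorem gg_V_ge {Z ι : Type*} [Nonempty ι] {N : ℕ} (k : ι → Z → ℝ) (B : ℝ)
    (hB : ∀ i z, |k i z| ≤ B) (ε : Fin N → Bool) (S : Fin N → Z) (i : ι) (τ : ℝ)
    (hi : ∑ j, (if ε j then (0 : ℝ) else k i (S j)) ≤
      (⨅ i, ∑ j, (if ε j then (0 : ℝ) else k i (S j))) + τ) :
    (∑ j, if ε j then k i (S j) else 0) - τ ≤ ggV k ε S := by
  have h1 := le_ciSup (gg_bddAbove k B hB S _ (gg_c1 ε)) i
  have h2 : (∑ j, (if ε j then (1 : ℝ) else -1) * k i (S j)) =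
      (∑ j, if ε j then k i (S j) else 0) - ∑ j, (if ε j then (0 : ℝ) else k i (S j)) := by
    rw [← Finset.sum_sub_distrib]
    apply Finset.sum_congr rfl; intro j _; split_ifs <;> simp
  unfold ggV
  linarith

theorem gg_V_meas {Z ι : Type*} [MeasurableSpace Z] [Countable ι] {N : ℕ} (k : ι → Z → ℝ)
    (hk : ∀ i, Measurable (k i)) (ε : Fin N → Bool) : Measurable (ggV k ε) := by
  unfold ggV
  apply Measurable.add
  · apply Measurable.iSup
    intro i
    fun_prop
  · apply Measurable.iInf
    intro i
    refine Finset.measurable_sum _ fun j _ => ?_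
    by_cases h : ε j <;> simp only [h]
    · exact measurable_const
    · simp only [Bool.false_eq_true, if_false]
      exact (hk i).comp (measurable_pi_apply j)

theorem gg_V_lint {Z ι : Type*} [MeasurableSpace Z] [Countable ι] [Nonempty ι] {N : ℕ}
    (D : Measure Z) [IsProbabilityMeasure D] (k : ι → Z → ℝ) (B : ℝ)
    (hB : ∀ i z, |k i z| ≤ B) (hk : ∀ i, Measurable (k i)) (u M : ℝ) (hu : 0 ≤ u)
    (hM : ∀ i, ∫ z, Real.exp (-(u * k i z)) ∂D ≤ M) (ε : Fin N → Bool) :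
    ∫⁻ S, ENNReal.ofReal (Real.exp (-(u * ggV k ε S))) ∂(Measure.pi fun _ : Fin N => D) ≤
      ENNReal.ofReal (∏ j, if ε j then M else 1) := by
  have hmp := measurePreserving_piEquivPiSubtypeProd (fun _ : Fin N => D) (fun j => ε j = true)
  set e := MeasurableEquiv.piEquivPiSubtypeProd (fun _ : Fin N => Z) (fun j => ε j = true) with he
  have hg : Measurable fun S : Fin N → Z => ENNReal.ofReal (Real.exp (-(u * ggV k ε S))) := by
    have := gg_V_meas k hk ε
    fun_prop
  have hes : ∀ ab, ∀ j, e.symm ab j = if h : ε j = true then ab.1 ⟨j, h⟩ else ab.2 ⟨j, h⟩ := by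
    intro ab j; rfl
  rw [← hmp.symm.lintegral_comp hg]
  have key : ∀ τ : ℝ, 0 < τ → ∫⁻ ab, ENNReal.ofReal (Real.exp (-(u * ggV k ε (e.symm ab))))
      ∂((Measure.pi fun _ : {j // ε j = true} => D).prod
        (Measure.pi fun _ : {j // ¬ ε j = true} => D)) ≤
      ENNReal.ofReal (Real.exp (u * τ) * ∏ j, if ε j then M else 1) := by
    intro τ hτ
    rw [lintegral_prod_symm (fun ab => ENNReal.ofReal (Real.exp (-(u * ggV k ε (e.symm ab)))))
      (hg.comp e.symm.measurable).aemeasurable]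
    have inner : ∀ b, ∫⁻ a, ENNReal.ofReal (Real.exp (-(u * ggV k ε (e.symm (a, b)))))
        ∂(Measure.pi fun _ : {j // ε j = true} => D) ≤
        ENNReal.ofReal (Real.exp (u * τ) * ∏ j, if ε j then M else 1) := by
      intro b
      set c : ι → ℝ := fun i => ∑ j, if h : ε j = true then (0 : ℝ) else k i (b ⟨j, h⟩) with hc
      have hcc : ∀ a i, ∑ j, (if ε j then (0 : ℝ) else k i (e.symm (a, b) j)) = c i := by
        intro a i
        apply Finset.sum_congr rfl; intro j _
        by_cases h : ε j = true
        · simp [h]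
        · simp [h, hes]
      obtain ⟨i, hi⟩ : ∃ i, c i < (⨅ i, c i) + τ := exists_lt_of_ciInf_lt (by linarith)
      have hpt : ∀ a, Real.exp (-(u * ggV k ε (e.symm (a, b)))) ≤
          Real.exp (u * τ) * ∏ j : {j // ε j = true}, Real.exp (-(u * k i (a j))) := by
        intro a
        have h1 := gg_V_ge k B hB ε (e.symm (a, b)) i τ (by simp only [hcc]; exact hi.le)
        have h2 : (∑ j, if ε j then k i (e.symm (a, b) j) else 0) =
            ∑ j : {j // ε j = true}, k i (a j) := by
          rw [← Finset.sum_filter, Finset.sum_subtype (p := fun j => ε j = true) _ (by simp)]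
          apply Finset.sum_congr rfl; intro j _
          rw [hes]; simp [j.2]
        rw [h2] at h1
        rw [← Real.exp_sum, ← Real.exp_add]
        apply Real.exp_le_exp.2
        rw [Finset.sum_neg_distrib, ← Finset.mul_sum]
        nlinarith
      have hint1 : Integrable (fun z => Real.exp (-(u * k i z))) D := by
        refine Integrable.of_bound (C := Real.exp (u * B)) ?_ ?_
        · have := hk i
          exact Measurable.aestronglyMeasurable (by fun_prop)
        · refine Filter.Eventually.of_forall fun z => ?_
          rw [Real.norm_of_nonneg (Real.exp_pos _).le]
          apply Real.exp_le_exp.2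
          have := (abs_le.1 (hB i z)).1
          nlinarith
      have hint : Integrable (fun a : {j // ε j = true} → Z =>
          ∏ j : {j // ε j = true}, Real.exp (-(u * k i (a j))))
          (Measure.pi fun _ : {j // ε j = true} => D) :=
        Integrable.fintype_prod (f := fun _ z => Real.exp (-(u * k i z))) (fun _ => hint1)
      calc ∫⁻ a, ENNReal.ofReal (Real.exp (-(u * ggV k ε (e.symm (a, b)))))
            ∂(Measure.pi fun _ : {j // ε j = true} => D)
          ≤ ∫⁻ a, ENNReal.ofReal (Real.exp (u * τ) *
              ∏ j : {j // ε j = true}, Real.exp (-(u * k i (a j))))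
            ∂(Measure.pi fun _ : {j // ε j = true} => D) :=
            lintegral_mono fun a => ENNReal.ofReal_le_ofReal (hpt a)
        _ = ENNReal.ofReal (∫ a, (Real.exp (u * τ) *
              ∏ j : {j // ε j = true}, Real.exp (-(u * k i (a j))))
            ∂(Measure.pi fun _ : {j // ε j = true} => D)) := by
            rw [ofReal_integral_eq_lintegral_ofReal (hint.const_mul _)]
            exact Filter.Eventually.of_forall fun a => mul_nonneg (Real.exp_pos _).le (Finset.prod_nonneg fun j _ => (Real.exp_pos _).le)
        _ ≤ _ := by
            apply ENNReal.ofReal_le_ofReal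
            rw [integral_const_mul]
            apply mul_le_mul_of_nonneg_left _ (Real.exp_pos _).le
            rw [integral_fintype_prod_eq_prod (f := fun (_ : {j // ε j = true}) z => Real.exp (-(u * k i z)))]
            rw [← Finset.prod_filter, Finset.prod_subtype (p := fun j => ε j = true) _ (by simp)]
            apply Finset.prod_le_prod
            · intro j _; exact integral_nonneg fun z => (Real.exp_pos _).le
            · intro j _; exact hM i
    calc _ ≤ ∫⁻ _b, ENNReal.ofReal (Real.exp (u * τ) * ∏ j, if ε j then M else 1)
          ∂(Measure.pi fun _ : {j // ¬ ε j = true} => D) := lintegral_mono inner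
      _ = _ := by simp
  have hcont : Continuous fun τ : ℝ => ENNReal.ofReal (Real.exp (u * τ) * ∏ j, if ε j then M else 1) := by
    apply ENNReal.continuous_ofReal.comp
    fun_prop
  have ht := (hcont.tendsto 0).mono_left (nhdsWithin_le_nhds (s := Set.Ioi 0))
  simp only [mul_zero, Real.exp_zero, one_mul] at ht
  exact ge_of_tendsto ht (by
    filter_upwards [self_mem_nhdsWithin] with τ hτ
    exact key τ hτ)

/-- `N` times (empirical infimum plus twice the empirical Rademacher complexity) -/
noncomputable def ggW {Z ι : Type*} {N : ℕ} (k : ι → Z → ℝ) (S : Fin N → Z) : ℝ :=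
  (⨅ i, ∑ j, k i (S j)) + 2 * ((2 ^ N : ℝ)⁻¹ * ∑ ε : Fin N → Bool,
    ⨆ i, ∑ j, (if ε j then (1 : ℝ) else -1) * k i (S j))

theorem gg_W_meas {Z ι : Type*} [MeasurableSpace Z] [Countable ι] {N : ℕ} (k : ι → Z → ℝ)
    (hk : ∀ i, Measurable (k i)) : Measurable (ggW (N := N) k) := by
  unfold ggW
  apply Measurable.add
  · apply Measurable.iInf
    intro i
    fun_prop
  · refine Measurable.const_mul (Measurable.const_mul (Finset.measurable_sum _ fun ε _ => ?_) _) _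
    apply Measurable.iSup
    intro i
    fun_prop

theorem gg_W_ge {Z ι : Type*} [Nonempty ι] {N : ℕ} (k : ι → Z → ℝ) (B : ℝ)
    (hB : ∀ i z, |k i z| ≤ B) (S : Fin N → Z) :
    2 * ((2 ^ N : ℝ)⁻¹ * ∑ ε : Fin N → Bool, ggV k ε S) ≤ ggW k S := by
  have hcard : (∑ _ε : Fin N → Bool, (1 : ℝ)) = 2 ^ N := by simp
  set J : (Fin N → Bool) → ℝ := fun ε => ⨅ i, ∑ j, (if ε j then (0 : ℝ) else k i (S j)) with hJ
  set I0 := ⨅ i, ∑ j, k i (S j) with hI0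
  have hbb : ∀ ε : Fin N → Bool, BddBelow (Set.range fun i => ∑ j, (if ε j then (0 : ℝ) else k i (S j))) := by
    intro ε
    have := gg_bddBelow k B hB S _ (gg_c2 ε)
    simpa only [gg_ite_mul] using this
  have h1 : ∀ ε : Fin N → Bool, J ε + J (fun j => !ε j) ≤ I0 := by
    intro ε
    apply le_ciInf
    intro i
    have ha := ciInf_le (hbb ε) i
    have hb := ciInf_le (hbb (fun j => !ε j)) i
    have hs : ∑ j, k i (S j) = (∑ j, (if ε j then (0 : ℝ) else k i (S j))) +
        ∑ j, (if (!ε j) then (0 : ℝ) else k i (S j)) := by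
      rw [← Finset.sum_add_distrib]
      apply Finset.sum_congr rfl; intro j _
      cases ε j <;> simp
    rw [hs]
    exact add_le_add ha hb
  have h2 : ∑ ε : Fin N → Bool, J (fun j => !ε j) = ∑ ε : Fin N → Bool, J ε := by
    let φ : (Fin N → Bool) ≃ (Fin N → Bool) := Equiv.piCongrRight fun _ => Equiv.boolNot
    exact Equiv.sum_comp φ J
  have h3 : 2 * ∑ ε : Fin N → Bool, J ε ≤ 2 ^ N * I0 := by
    have := Finset.sum_le_sum (s := (Finset.univ : Finset (Fin N → Bool))) fun ε _ => h1 ε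
    rw [Finset.sum_add_distrib, h2] at this
    simp at this
    linarith
  have h4 : 2 * ((2 ^ N : ℝ)⁻¹ * ∑ ε : Fin N → Bool, J ε) ≤ I0 := by
    have hp : (0 : ℝ) < 2 ^ N := by positivity
    have : 2 * ((2 ^ N : ℝ)⁻¹ * ∑ ε : Fin N → Bool, J ε) = (2 * ∑ ε : Fin N → Bool, J ε) / 2 ^ N := by
      field_simp
    rw [this, div_le_iff₀ hp]; linarith
  unfold ggW ggV
  rw [Finset.sum_add_distrib, mul_add, mul_add]
  linarith

theorem gg_W_lint {Z ι : Type*} [MeasurableSpace Z] [Countable ι] [Nonempty ι] {N : ℕ}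
    (D : Measure Z) [IsProbabilityMeasure D] (k : ι → Z → ℝ) (B : ℝ)
    (hB : ∀ i z, |k i z| ≤ B) (hk : ∀ i, Measurable (k i)) (u M : ℝ) (hu : 0 ≤ u)
    (hM : ∀ i, ∫ z, Real.exp (-(u * k i z)) ∂D ≤ M) :
    ∫⁻ S, ENNReal.ofReal (Real.exp (-(u / 2 * ggW k S))) ∂(Measure.pi fun _ : Fin N => D) ≤
      ENNReal.ofReal (((1 + M) / 2) ^ N) := by
  have hM0 : 0 ≤ M := (integral_nonneg fun z => (Real.exp_pos _).le).trans (hM (Classical.arbitrary ι))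
  have hp : (0 : ℝ) < 2 ^ N := by positivity
  have hpt : ∀ S : Fin N → Z, Real.exp (-(u / 2 * ggW k S)) ≤
      ∑ ε : Fin N → Bool, (2 ^ N : ℝ)⁻¹ * Real.exp (-(u * ggV k ε S)) := by
    intro S
    have h1 := gg_W_ge k B hB S
    have h2 : Real.exp (-(u / 2 * ggW k S)) ≤
        Real.exp (∑ ε : Fin N → Bool, (2 ^ N : ℝ)⁻¹ • (-(u * ggV k ε S))) := by
      apply Real.exp_le_exp.2
      have : ∑ ε : Fin N → Bool, (2 ^ N : ℝ)⁻¹ • (-(u * ggV k ε S)) =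
          -(u / 2 * (2 * ((2 ^ N : ℝ)⁻¹ * ∑ ε : Fin N → Bool, ggV k ε S))) := by
        simp only [smul_eq_mul, mul_neg, Finset.sum_neg_distrib, ← Finset.mul_sum]
        ring
      rw [this]
      nlinarith
    refine h2.trans ?_
    have := convexOn_exp.map_sum_le (t := (Finset.univ : Finset (Fin N → Bool)))
      (w := fun _ => (2 ^ N : ℝ)⁻¹) (p := fun ε => -(u * ggV k ε S))
      (fun _ _ => by positivity) (by simp) (fun _ _ => Set.mem_univ _)
    simpa using this
  calc _ ≤ ∫⁻ S, ∑ ε : Fin N → Bool, ENNReal.ofReal (2 ^ N : ℝ)⁻¹ *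
          ENNReal.ofReal (Real.exp (-(u * ggV k ε S))) ∂(Measure.pi fun _ : Fin N => D) := by
        apply lintegral_mono
        intro S
        refine (ENNReal.ofReal_le_ofReal (hpt S)).trans ?_
        rw [ENNReal.ofReal_sum_of_nonneg (fun _ _ => by positivity)]
        apply Finset.sum_le_sum
        intro ε _
        rw [ENNReal.ofReal_mul (by positivity)]
    _ = ∑ ε : Fin N → Bool, ENNReal.ofReal (2 ^ N : ℝ)⁻¹ *
          ∫⁻ S, ENNReal.ofReal (Real.exp (-(u * ggV k ε S))) ∂(Measure.pi fun _ : Fin N => D) := by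
        have hm : ∀ ε : Fin N → Bool, Measurable fun S : Fin N → Z =>
            ENNReal.ofReal (Real.exp (-(u * ggV k ε S))) := by
          intro ε
          have := gg_V_meas k hk ε
          fun_prop
        rw [lintegral_finsetSum _ (fun ε _ => (hm ε).const_mul _)]
        apply Finset.sum_congr rfl; intro ε _
        rw [lintegral_const_mul _ (hm ε)]
    _ ≤ ∑ ε : Fin N → Bool, ENNReal.ofReal (2 ^ N : ℝ)⁻¹ *
          ENNReal.ofReal (∏ j, if ε j then M else 1) := by
        apply Finset.sum_le_sum
        intro ε _
        gcongr
        exact gg_V_lint D k B hB hk u M hu hM ε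
    _ = ENNReal.ofReal (((1 + M) / 2) ^ N) := by
        have hnn : ∀ ε : Fin N → Bool, 0 ≤ ∏ j, (if ε j then M else 1) := fun ε =>
          Finset.prod_nonneg fun j _ => by split_ifs <;> positivity
        have : ∀ ε : Fin N → Bool, ENNReal.ofReal (2 ^ N : ℝ)⁻¹ *
            ENNReal.ofReal (∏ j, if ε j then M else 1) =
            ENNReal.ofReal ((2 ^ N : ℝ)⁻¹ * ∏ j, if ε j then M else 1) := fun ε => by
          rw [ENNReal.ofReal_mul (by positivity)]
        simp only [this]
        rw [← ENNReal.ofReal_sum_of_nonneg (fun ε _ => mul_nonneg (by positivity) (hnn ε))]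
        congr 1
        rw [← Finset.mul_sum]
        have hsum : ∑ ε : Fin N → Bool, ∏ j, (if ε j then M else 1) = (1 + M) ^ N := by
          have := Fintype.prod_sum (fun (_ : Fin N) (b : Bool) => if b then M else (1 : ℝ))
          simp at this
          rw [← this]; ring
        rw [hsum, div_pow]; field_simp

theorem gg_iSup_sub {ι : Type*} [Nonempty ι] (g : ι → ℝ) (a : ℝ) (h : BddAbove (Set.range g)) :
    ⨆ i, (g i - a) = (⨆ i, g i) - a := by
  have := (OrderIso.addRight (-a)).map_ciSup h
  simpa [sub_eq_add_neg] using this.symm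

theorem gg_iInf_sub {ι : Type*} [Nonempty ι] (g : ι → ℝ) (a : ℝ) (h : BddBelow (Set.range g)) :
    ⨅ i, (g i - a) = (⨅ i, g i) - a := by
  have := (OrderIso.addRight (-a)).map_ciInf h
  simpa [sub_eq_add_neg] using this.symm

theorem gg_sgn_sum (N : ℕ) : ∑ ε : Fin N → Bool, ∑ j, (if ε j then (1 : ℝ) else -1) = 0 := by
  let φ : (Fin N → Bool) ≃ (Fin N → Bool) := Equiv.piCongrRight fun _ => Equiv.boolNot
  have h := Equiv.sum_comp φ (fun ε => ∑ j, (if ε j then (1 : ℝ) else -1))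
  have h2 : ∀ ε, ∑ j, (if φ ε j then (1 : ℝ) else -1) = -∑ j, (if ε j then (1 : ℝ) else -1) := by
    intro ε
    rw [← Finset.sum_neg_distrib]
    apply Finset.sum_congr rfl; intro j _
    have : φ ε j = !ε j := rfl
    rw [this]; cases ε j <;> simp
  simp only [h2, Finset.sum_neg_distrib] at h
  linarith

theorem gg_W_shift {Z ι : Type*} [Nonempty ι] {N : ℕ} (k : ι → Z → ℝ) (B : ℝ)
    (hB : ∀ i z, |k i z| ≤ B) (S : Fin N → Z) (R : ℝ) :
    ggW (fun i z => k i z - R) S = ggW k S - N * R := by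
  unfold ggW
  have h1 : ∀ i, ∑ j, (k i (S j) - R) = (∑ j, k i (S j)) - N * R := by
    intro i; simp [Finset.sum_sub_distrib]
  have h2 : ∀ (ε : Fin N → Bool) i, ∑ j, (if ε j then (1 : ℝ) else -1) * (k i (S j) - R) =
      (∑ j, (if ε j then (1 : ℝ) else -1) * k i (S j)) - (∑ j, (if ε j then (1 : ℝ) else -1)) * R := by
    intro ε i
    rw [Finset.sum_mul, ← Finset.sum_sub_distrib]
    apply Finset.sum_congr rfl; intro j _; ring
  simp only [h1, h2]
  rw [gg_iInf_sub]
  · have h3 : ∀ ε : Fin N → Bool, (⨆ i, ((∑ j, (if ε j then (1 : ℝ) else -1) * k i (S j)) -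
        (∑ j, (if ε j then (1 : ℝ) else -1)) * R)) =
        (⨆ i, (∑ j, (if ε j then (1 : ℝ) else -1) * k i (S j))) -
        (∑ j, (if ε j then (1 : ℝ) else -1)) * R := fun ε =>
      gg_iSup_sub _ _ (gg_bddAbove k B hB S _ (gg_c1 ε))
    simp only [h3, Finset.sum_sub_distrib, ← Finset.sum_mul, gg_sgn_sum]
    ring
  · have := gg_bddBelow k B hB S (fun _ => 1) (by simp)
    simpa using this

theorem gg_W_nonneg {Z ι : Type*} [Nonempty ι] {N : ℕ} (k : ι → Z → ℝ) (B : ℝ)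
    (hB : ∀ i z, |k i z| ≤ B) (h0 : ∀ i z, 0 ≤ k i z) (S : Fin N → Z) : 0 ≤ ggW k S := by
  refine le_trans ?_ (gg_W_ge k B hB S)
  refine mul_nonneg (by norm_num) (mul_nonneg (by positivity) (Finset.sum_nonneg fun ε _ => ?_))
  apply le_of_forall_pos_le_add
  intro τ hτ
  obtain ⟨i, hi⟩ := exists_lt_of_ciInf_lt (f := fun i => ∑ j, (if ε j then (0 : ℝ) else k i (S j)))
    (a := (⨅ i, ∑ j, (if ε j then (0 : ℝ) else k i (S j))) + τ) (by linarith)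
  have h1 := gg_V_ge k B hB ε S i τ hi.le
  have h2 : 0 ≤ ∑ j, (if ε j then k i (S j) else 0) :=
    Finset.sum_nonneg fun j _ => by split_ifs; exacts [h0 _ _, le_rfl]
  linarith

theorem gg_conc {X ι : Type*} [MeasurableSpace X] [Countable ι] [Nonempty ι]
    (D : Measure (X × Bool)) [IsProbabilityMeasure D] (N : ℕ) (hN : 1 ≤ N)
    (f : ι → X → ℝ) (hf : ∀ i, Measurable (f i)) (h0 : ∀ i x, 0 ≤ f i x) (h1 : ∀ i x, f i x ≤ 1)
    (δ : ℝ) (hδ : δ ∈ Set.Ioo (0 : ℝ) 1) :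
    ENNReal.ofReal (1 - δ) ≤ (Measure.pi fun _ : Fin N => D)
      {S | N * ggR D ≤ ggW (fun i (z : X × Bool) => (f i z.1 - (if z.2 then (1 : ℝ) else 0)) ^ 2) S +
        N * Real.sqrt (Real.log (1 / δ) / (2 * N))} := by
  set t := Real.sqrt (Real.log (1 / δ) / (2 * N)) with ht
  have hNpos : (0 : ℝ) < N := by exact_mod_cast hN
  have hlog : 0 < Real.log (1 / δ) := Real.log_pos (by rw [lt_div_iff₀ hδ.1]; linarith [hδ.2])
  have ht0 : 0 < t := Real.sqrt_pos.2 (by positivity)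
  have ht2 : 2 * N * t ^ 2 = Real.log (1 / δ) := by
    rw [ht, Real.sq_sqrt (by positivity)]; field_simp
  set ℓ : ι → X × Bool → ℝ := fun i z => (f i z.1 - (if z.2 then (1 : ℝ) else 0)) ^ 2 with hℓ
  have hℓm : ∀ i, Measurable (ℓ i) := fun i => gg_loss_meas (f i) (hf i)
  have hℓ0 : ∀ i z, 0 ≤ ℓ i z := fun i z => (gg_loss_bd (f i) (h0 i) (h1 i) z).1
  have hℓ1 : ∀ i z, ℓ i z ≤ 1 := fun i z => (gg_loss_bd (f i) (h0 i) (h1 i) z).2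
  have hℓB : ∀ i z, |ℓ i z| ≤ 1 := fun i z => by rw [abs_of_nonneg (hℓ0 i z)]; exact hℓ1 i z
  have hR0 := ggR_nonneg D
  have hR1 := ggR_le D
  rcases le_or_gt t (1 / 4) with htq | htq
  · set k : ι → X × Bool → ℝ := fun i z => ℓ i z - ggR D with hk
    have hkB : ∀ i z, |k i z| ≤ 1 := fun i z => by
      have := hℓ0 i z
      have := hℓ1 i z
      simp only [hk]
      rw [abs_le]; constructor <;> linarith
    have hkm : ∀ i, Measurable (k i) := fun i => (hℓm i).sub_const _
    have hlint := gg_W_lint (N := N) D k 1 hkB hkm (6 * t) (1 + (6 * t) ^ 2 / 18) (by positivity)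
      (fun i => gg_mgf D (f i) (hf i) (h0 i) (h1 i) (6 * t) (by positivity) (by linarith))
    have hWm : Measurable (ggW (N := N) k) := gg_W_meas k hkm
    set μ := (Measure.pi fun _ : Fin N => D) with hμ
    set bad : Set (Fin N → X × Bool) := {S | Real.exp (3 * N * t ^ 2) ≤ Real.exp (-(6 * t / 2 * ggW k S))}
      with hbad
    have hbadm : MeasurableSet bad := by
      apply measurableSet_le measurable_const
      fun_prop
    have hmarkov : μ bad ≤ ENNReal.ofReal δ := by
      have h2 := mul_meas_ge_le_lintegral (μ := μ)
        (f := fun S => ENNReal.ofReal (Real.exp (-(6 * t / 2 * ggW k S)))) (by fun_prop)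
        (ENNReal.ofReal (Real.exp (3 * N * t ^ 2)))
      have h3 : bad ⊆ {S | ENNReal.ofReal (Real.exp (3 * N * t ^ 2)) ≤
          ENNReal.ofReal (Real.exp (-(6 * t / 2 * ggW k S)))} := fun S hS =>
        ENNReal.ofReal_le_ofReal hS
      have h4 : ENNReal.ofReal (Real.exp (3 * N * t ^ 2)) * μ bad ≤
          ENNReal.ofReal (Real.exp (N * t ^ 2)) := by
        calc _ ≤ _ := mul_le_mul_right (measure_mono h3) _
          _ ≤ _ := h2
          _ ≤ _ := hlint
          _ ≤ _ := by
            apply ENNReal.ofReal_le_ofReal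
            rw [show ((N : ℝ) * t ^ 2) = (N : ℕ) * t ^ 2 from rfl, Real.exp_nat_mul]
            apply pow_le_pow_left₀ (by positivity)
            have := Real.add_one_le_exp (t ^ 2)
            linarith
      have h5 : ENNReal.ofReal (Real.exp (N * t ^ 2)) =
          ENNReal.ofReal (Real.exp (3 * N * t ^ 2)) * ENNReal.ofReal δ := by
        rw [← ENNReal.ofReal_mul (Real.exp_pos _).le]
        congr 1
        have : δ = Real.exp (-(2 * N * t ^ 2)) := by
          rw [ht2, one_div, Real.log_inv, neg_neg, Real.exp_log hδ.1]
        rw [this, ← Real.exp_add]; congr 1; ring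
      rw [h5] at h4
      exact (ENNReal.mul_le_mul_iff_right (by simp [Real.exp_pos]) ENNReal.ofReal_ne_top).1 h4
    have hsub : badᶜ ⊆ {S | N * ggR D ≤ ggW ℓ S + N * t} := by
      intro S hS
      simp only [hbad, Set.mem_compl_iff, Set.mem_ofPred_eq, not_le, Real.exp_lt_exp] at hS
      have hsh : ggW k S = ggW ℓ S - N * ggR D := gg_W_shift ℓ 1 hℓB S (ggR D)
      have : -(ggW k S) < N * t := by
        have : 3 * t * (-(ggW k S)) < 3 * t * (N * t) := by nlinarith
        exact lt_of_mul_lt_mul_left this (by positivity)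
      simp only [Set.mem_ofPred_eq]
      linarith
    calc ENNReal.ofReal (1 - δ) = 1 - ENNReal.ofReal δ := by
          rw [ENNReal.ofReal_sub _ hδ.1.le, ENNReal.ofReal_one]
      _ ≤ 1 - μ bad := tsub_le_tsub_left hmarkov _
      _ = μ badᶜ := (prob_compl_eq_one_sub hbadm).symm
      _ ≤ _ := measure_mono hsub
  · have : {S : Fin N → X × Bool | N * ggR D ≤ ggW ℓ S + N * t} = Set.univ := by
      ext S
      simp only [Set.mem_ofPred_eq, Set.mem_univ, iff_true]
      have := gg_W_nonneg ℓ 1 hℓB hℓ0 S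
      nlinarith
    rw [this, measure_univ]
    rw [ENNReal.ofReal_le_one]; linarith [hδ.1]

theorem gg_gabor (θ lam ψ k1 k2 x y : ℝ) (h1 : 2 * Real.pi * Real.cos θ / lam = k1)
    (h2 : 2 * Real.pi * Real.sin θ / lam = k2) :
    gabor θ 1 1 lam ψ x y = Real.exp (-(x ^ 2 + y ^ 2) / 2) * Real.cos (k1 * x + k2 * y + ψ) := by
  unfold gabor
  simp only []
  have hs := Real.sin_sq_add_cos_sq θ
  congr 2
  · have : (x * Real.cos θ + y * Real.sin θ) ^ 2 +
      1 ^ 2 * (-x * Real.sin θ + y * Real.cos θ) ^ 2 = x ^ 2 + y ^ 2 := by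
      linear_combination (x ^ 2 + y ^ 2) * hs
    rw [this]; norm_num
  · rw [← h1, ← h2]; ring

/-- sum against a plane wave kernel -/
theorem gg_wave (θ lam ψ k1 k2 : ℝ) (h1 : 2 * Real.pi * Real.cos θ / lam = k1)
    (h2 : 2 * Real.pi * Real.sin θ / lam = k2) (u : Fin 3 → Fin 3 → ℝ)
    (h : ∑ s : Fin 3, ∑ t : Fin 3, u s t * gaborKernel θ 1 1 lam ψ s t = 0) :
    ∑ s : Fin 3, ∑ t : Fin 3,
      (u s t * Real.exp (-((coord s) ^ 2 + (coord t) ^ 2) / 2)) *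
        Real.cos (k1 * coord s + k2 * coord t + ψ) = 0 := by
  rw [← h]
  refine Finset.sum_congr rfl fun s _ => Finset.sum_congr rfl fun t _ => ?_
  unfold gaborKernel
  rw [gg_gabor θ lam ψ k1 k2 _ _ h1 h2]; ring

theorem gg_cz : coord 0 = -1 := by simp [coord]
theorem gg_co : coord 1 = 0 := by simp [coord]
theorem gg_ct : coord 2 = 1 := by simp [coord]; norm_num

noncomputable def ggTheta : Fin 9 → ℝ :=
  ![0, 0, 0, Real.pi / 2, Real.pi / 2, Real.pi / 4, Real.pi / 4, -(Real.pi / 4), -(Real.pi / 4)]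
noncomputable def ggLam : Fin 9 → ℝ :=
  ![1, 4, 4, 4, 4, 2 * Real.sqrt 2, 2 * Real.sqrt 2, 2 * Real.sqrt 2, 2 * Real.sqrt 2]
noncomputable def ggPsi : Fin 9 → ℝ :=
  ![0, 0, -(Real.pi / 2), 0, -(Real.pi / 2), 0, -(Real.pi / 2), 0, -(Real.pi / 2)]

theorem gg_window (u : Fin 3 → Fin 3 → ℝ)
    (h : ∀ n : Fin 9, ∑ s : Fin 3, ∑ t : Fin 3,
      u s t * gaborKernel (ggTheta n) 1 1 (ggLam n) (ggPsi n) s t = 0) : ∀ s t, u s t = 0 := by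
  have hs2 : Real.sqrt 2 * Real.sqrt 2 = 2 := Real.mul_self_sqrt (by norm_num)
  have hsp : Real.sqrt 2 ≠ 0 := by positivity
  have e4c : 2 * Real.pi * Real.cos (Real.pi / 4) / (2 * Real.sqrt 2) = Real.pi / 2 := by
    rw [Real.cos_pi_div_four]; field_simp
  have e4s : 2 * Real.pi * Real.sin (Real.pi / 4) / (2 * Real.sqrt 2) = Real.pi / 2 := by
    rw [Real.sin_pi_div_four]; field_simp
  have h0 := gg_wave 0 1 0 (2 * Real.pi) 0 (by simp) (by simp) u (h 0)
  have h1 := gg_wave 0 4 0 (Real.pi / 2) 0 (by simp; ring) (by simp) u (h 1)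
  have h2 := gg_wave 0 4 (-(Real.pi / 2)) (Real.pi / 2) 0 (by simp; ring) (by simp) u (h 2)
  have h3 := gg_wave (Real.pi / 2) 4 0 0 (Real.pi / 2) (by simp) (by simp; ring) u (h 3)
  have h4 := gg_wave (Real.pi / 2) 4 (-(Real.pi / 2)) 0 (Real.pi / 2) (by simp) (by simp; ring)
    u (h 4)
  have h5 := gg_wave (Real.pi / 4) (2 * Real.sqrt 2) 0 (Real.pi / 2) (Real.pi / 2) e4c e4s u (h 5)
  have h6 := gg_wave (Real.pi / 4) (2 * Real.sqrt 2) (-(Real.pi / 2)) (Real.pi / 2) (Real.pi / 2)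
    e4c e4s u (h 6)
  have h7 := gg_wave (-(Real.pi / 4)) (2 * Real.sqrt 2) 0 (Real.pi / 2) (-(Real.pi / 2))
    (by rw [Real.cos_neg]; exact e4c)
    (by rw [Real.sin_neg, mul_neg, neg_div]; exact congrArg Neg.neg e4s) u (h 7)
  have h8 := gg_wave (-(Real.pi / 4)) (2 * Real.sqrt 2) (-(Real.pi / 2)) (Real.pi / 2)
    (-(Real.pi / 2))
    (by rw [Real.cos_neg]; exact e4c)
    (by rw [Real.sin_neg, mul_neg, neg_div]; exact congrArg Neg.neg e4s) u (h 8)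
  clear h
  suffices H : ∀ s t, u s t * Real.exp (-((coord s) ^ 2 + (coord t) ^ 2) / 2) = 0 by
    intro s t
    exact (mul_eq_zero.1 (H s t)).resolve_right (Real.exp_pos _).ne'
  set v : Fin 3 → Fin 3 → ℝ := fun s t => u s t * Real.exp (-((coord s) ^ 2 + (coord t) ^ 2) / 2)
    with hv
  have hvv : ∀ s t, u s t * Real.exp (-((coord s) ^ 2 + (coord t) ^ 2) / 2) = v s t :=
    fun _ _ => rfl
  simp only [hvv] at h0 h1 h2 h3 h4 h5 h6 h7 h8 ⊢
  clear_value v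
  have c1 : Real.cos (-(Real.pi / 2)) = 0 := by rw [Real.cos_neg, Real.cos_pi_div_two]
  have c2 : ∀ x, Real.cos (x + -(Real.pi / 2)) = Real.sin x := fun x => by
    rw [← sub_eq_add_neg, Real.cos_sub_pi_div_two]
  have r1 : Real.pi / 2 + Real.pi / 2 = Real.pi := by ring
  have r2 : -(Real.pi / 2) + -(Real.pi / 2) = -Real.pi := by ring
  simp only [Fin.sum_univ_three, gg_cz, gg_co, gg_ct, mul_neg, mul_one, mul_zero, add_zero,
    zero_add, neg_zero, c2, zero_mul, neg_neg, r1, r2, Real.cos_neg, Real.cos_zero, Real.cos_pi,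
    Real.cos_two_pi, Real.cos_pi_div_two, Real.sin_neg, Real.sin_zero, Real.sin_pi,
    Real.sin_pi_div_two, add_neg_cancel, neg_add_cancel] at h0 h1 h2 h3 h4 h5 h6 h7 h8
  intro s t
  fin_cases s <;> fin_cases t <;> simp only [Fin.zero_eta, Fin.mk_one, Fin.reduceFinMk] <;> linarith

theorem gg_wd (p : ℕ) (hp : 3 ≤ p) (x : Matrix (Fin p) (Fin p) ℝ)
    (h : ∀ n : Fin 9, conv2d p p 3 hp hp
      (gaborKernel (ggTheta n) 1 1 (ggLam n) (ggPsi n)) x = 0) : x = 0 := by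
  have key : ∀ (i j : Fin (p - 3 + 1)) (s t : Fin 3),
      x ⟨i.val + s.val, by have h1 := i.isLt; have h2 := s.isLt; omega⟩
      ⟨j.val + t.val, by have h1 := j.isLt; have h2 := t.isLt; omega⟩ = 0 := by
    intro i j
    exact gg_window (fun s t => x ⟨i.val + s.val, by have h1 := i.isLt; have h2 := s.isLt; omega⟩
      ⟨j.val + t.val, by have h1 := j.isLt; have h2 := t.isLt; omega⟩)
      (fun n => congrFun (congrFun (h n) i) j)
  have dec : ∀ a : Fin p, ∃ (i : Fin (p - 3 + 1)) (s : Fin 3), i.val + s.val = a.val := by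
    intro a
    have ha := a.isLt
    by_cases h3 : a.val < p - 3 + 1
    · exact ⟨⟨a.val, h3⟩, 0, by simp⟩
    · refine ⟨⟨p - 3, by omega⟩, ⟨a.val - (p - 3), by omega⟩, ?_⟩
      simp only []; omega
  ext a b
  obtain ⟨i, s, hi⟩ := dec a
  obtain ⟨j, t, hj⟩ := dec b
  have := key i j s t
  simp only [hi, hj] at this
  exact this

theorem gg_sig_cont : Continuous sigmoid := by
  unfold sigmoid
  refine Continuous.div continuous_const (by fun_prop) fun x => ?_
  have := Real.exp_pos (-x)
  positivity

theorem gg_sig_nonneg (t : ℝ) : 0 ≤ sigmoid t := by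
  unfold sigmoid; positivity

theorem gg_sig_le (t : ℝ) : sigmoid t ≤ 1 := by
  unfold sigmoid
  have := Real.exp_pos (-t)
  rw [div_le_one (by positivity)]; linarith

theorem gg_sig_inj : Function.Injective sigmoid := by
  intro a b h
  unfold sigmoid at h
  have ha := Real.exp_pos (-a)
  have hb := Real.exp_pos (-b)
  rw [div_eq_div_iff (by positivity) (by positivity)] at h
  have : Real.exp (-a) = Real.exp (-b) := by linarith
  have := Real.exp_injective this
  linarith

theorem gg_sig_lip (a b : ℝ) : |sigmoid a - sigmoid b| ≤ |a - b| := by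
  have key : ∀ a b : ℝ, b ≤ a → 0 ≤ sigmoid a - sigmoid b ∧ sigmoid a - sigmoid b ≤ a - b := by
    intro a b hab
    have ha := Real.exp_pos (-a)
    have hb := Real.exp_pos (-b)
    have hle : Real.exp (-a) ≤ Real.exp (-b) := Real.exp_le_exp.2 (by linarith)
    have e : sigmoid a - sigmoid b = (Real.exp (-b) - Real.exp (-a)) /
        ((1 + Real.exp (-a)) * (1 + Real.exp (-b))) := by
      unfold sigmoid; field_simp; ring
    refine ⟨by rw [e]; exact div_nonneg (by linarith) (by positivity), ?_⟩
    rw [e, div_le_iff₀ (by positivity)]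
    have h1 : Real.exp (-b) * (1 - (a - b)) ≤ Real.exp (-a) := by
      have := Real.add_one_le_exp (-(a - b))
      have h2 : Real.exp (-a) = Real.exp (-b) * Real.exp (-(a - b)) := by
        rw [← Real.exp_add]; congr 1; ring
      rw [h2]; apply mul_le_mul_of_nonneg_left _ hb.le; linarith
    have h3 : 0 ≤ (a - b) * (1 + Real.exp (-a) + Real.exp (-a) * Real.exp (-b)) :=
      mul_nonneg (by linarith) (by positivity)
    nlinarith
  rcases le_total b a with h | h
  · have := key a b h
    rw [abs_of_nonneg this.1, abs_of_nonneg (by linarith)]; exact this.2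
  · have := key b a h
    rw [abs_sub_comm, abs_sub_comm a b, abs_of_nonneg this.1, abs_of_nonneg (by linarith)]
    exact this.2

theorem gg_sig_logit (y : ℝ) (h0 : 0 < y) (h1 : y < 1) :
    sigmoid (Real.log y - Real.log (1 - y)) = y := by
  unfold sigmoid
  have : (0 : ℝ) < 1 - y := by linarith
  rw [neg_sub, Real.exp_sub, Real.exp_log h0, Real.exp_log this]
  field_simp; ring

theorem gg_lin_cont {Q : Type*} [Fintype Q] (a : Q → ℝ) :
    Continuous fun k : Set.Icc (0 : Q → ℝ) 1 => ∑ q, a q * k.1 q :=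
  continuous_finsetSum _ fun q _ =>
    continuous_const.mul ((continuous_apply q).comp continuous_subtype_val)

/-- one sigmoid neuron as a continuous function on the cube -/
noncomputable def ggNeuron {Q : Type*} [Fintype Q] (w : (Q → ℝ) × ℝ) :
    C(Set.Icc (0 : Q → ℝ) 1, ℝ) :=
  ⟨fun k => sigmoid ((∑ q, w.1 q * k.1 q) + w.2), by
    exact gg_sig_cont.comp ((gg_lin_cont w.1).add continuous_const)⟩

noncomputable def ggE {Q : Type*} [Fintype Q] (a : Q → ℝ) : C(Set.Icc (0 : Q → ℝ) 1, ℝ) :=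
  ⟨fun k => Real.exp (∑ q, a q * k.1 q), Real.continuous_exp.comp (gg_lin_cont a)⟩

theorem gg_approx (t n : ℝ) : |Real.exp n * sigmoid (t + -n) - Real.exp t| ≤
    Real.exp (2 * t) * Real.exp (-n) := by
  unfold sigmoid
  have e : -(t + -n) = n - t := by ring
  rw [e]
  have h1 := Real.exp_pos (n - t)
  have h2 : Real.exp n = Real.exp t * Real.exp (n - t) := by rw [← Real.exp_add]; congr 1; ring
  have h3 : Real.exp (2 * t) * Real.exp (-n) * Real.exp (n - t) = Real.exp t := by
    rw [← Real.exp_add, ← Real.exp_add]; congr 1; ring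
  have e2 : Real.exp n * (1 / (1 + Real.exp (n - t))) - Real.exp t =
      -(Real.exp t / (1 + Real.exp (n - t))) := by
    rw [h2]; field_simp; ring
  rw [e2, abs_neg, abs_of_nonneg (by positivity), div_le_iff₀ (by positivity)]
  have : 0 < Real.exp (2 * t) * Real.exp (-n) := by positivity
  nlinarith

theorem gg_dense {Q : Type*} [Fintype Q] :
    (Submodule.span ℝ (Set.range (ggNeuron (Q := Q)))).topologicalClosure = ⊤ := by
  set P := Submodule.span ℝ (Set.range (ggNeuron (Q := Q))) with hP
  have hE : ∀ a : Q → ℝ, ggE a ∈ P.topologicalClosure := by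
    intro a
    set M := ∑ q, |a q| with hM
    have hlim : Filter.Tendsto (fun n : ℕ => Real.exp (n : ℝ) • ggNeuron (a, -(n : ℝ)))
        Filter.atTop (nhds (ggE a)) := by
      rw [tendsto_iff_dist_tendsto_zero]
      have hz : Filter.Tendsto (fun n : ℕ => Real.exp (2 * M) * Real.exp (-(n : ℝ)))
          Filter.atTop (nhds 0) := by
        have := (Real.tendsto_exp_neg_atTop_nhds_zero.comp
          (tendsto_natCast_atTop_atTop (R := ℝ))).const_mul (Real.exp (2 * M))
        simpa using this
      refine squeeze_zero (fun _ => dist_nonneg) (fun n => ?_) hz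
      rw [ContinuousMap.dist_le (by positivity)]
      intro k
      have hk : ∑ q, a q * k.1 q ≤ M := by
        apply Finset.sum_le_sum
        intro q _
        have h0 : 0 ≤ k.1 q := k.2.1 q
        have h1 : k.1 q ≤ 1 := k.2.2 q
        have := le_abs_self (a q)
        have := abs_nonneg (a q)
        nlinarith
      rw [Real.dist_eq]
      refine (gg_approx (∑ q, a q * k.1 q) n).trans ?_
      gcongr
    exact mem_closure_of_tendsto hlim (Filter.Eventually.of_forall fun n =>
      P.smul_mem _ (Submodule.subset_span ⟨_, rfl⟩))
  set A := Algebra.adjoin ℝ (Set.range (ggE (Q := Q))) with hA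
  have hmul : ∀ x ∈ Submonoid.closure (Set.range (ggE (Q := Q))), x ∈ Set.range (ggE (Q := Q)) := by
    intro x hx
    induction hx using Submonoid.closure_induction with
    | mem x h => exact h
    | one => exact ⟨0, by ext k; simp [ggE]⟩
    | mul x y _ _ hx hy =>
      obtain ⟨a, rfl⟩ := hx
      obtain ⟨b, rfl⟩ := hy
      refine ⟨a + b, ?_⟩
      ext k
      simp [ggE, add_mul, Finset.sum_add_distrib, Real.exp_add]
  have hAP : ∀ x ∈ A, x ∈ P.topologicalClosure := by
    intro x hx
    have : x ∈ Subalgebra.toSubmodule A := hx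
    rw [hA, Algebra.adjoin_eq_span] at this
    refine Submodule.span_le.2 ?_ this
    intro y hy
    obtain ⟨a, rfl⟩ := hmul y hy
    exact hE a
  have hsep : A.SeparatesPoints := by
    classical
    intro x y hxy
    obtain ⟨q, hq⟩ : ∃ q, x.1 q ≠ y.1 q := by
      by_contra! h
      exact hxy (Subtype.ext (funext h))
    refine ⟨_, ⟨ggE (Pi.single q 1), Algebra.subset_adjoin ⟨_, rfl⟩, rfl⟩, ?_⟩
    simp only [ggE, ContinuousMap.coe_mk]
    intro h
    have := Real.exp_injective h
    simp [Pi.single_apply] at this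
    exact hq this
  have htop := ContinuousMap.subalgebra_topologicalClosure_eq_top_of_separatesPoints A hsep
  rw [eq_top_iff]
  intro x _
  have hx : x ∈ A.topologicalClosure := by rw [htop]; trivial
  have hx' : x ∈ closure (A : Set C(Set.Icc (0 : Q → ℝ) 1, ℝ)) := hx
  exact closure_minimal (fun y hy => hAP y hy) P.isClosed_topologicalClosure hx'

theorem gg_uat_unif {Q : Type*} [Fintype Q] (g : C(Set.Icc (0 : Q → ℝ) 1, ℝ)) (δ : ℝ)
    (hδ : 0 < δ) : ∃ (d : ℕ) (A : Matrix (Fin d) Q ℝ) (b a : Fin d → ℝ),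
      ∀ k : Set.Icc (0 : Q → ℝ) 1,
        |(∑ i, a i * sigmoid (A.mulVec k.1 i + b i)) - g k| ≤ δ := by
  have hg : g ∈ (Submodule.span ℝ (Set.range (ggNeuron (Q := Q)))).topologicalClosure := by
    rw [gg_dense]; trivial
  have hg' : g ∈ closure ((Submodule.span ℝ (Set.range (ggNeuron (Q := Q))) :
    Submodule ℝ C(Set.Icc (0 : Q → ℝ) 1, ℝ)) : Set C(Set.Icc (0 : Q → ℝ) 1, ℝ)) := hg
  obtain ⟨f, hf, hd⟩ := Metric.mem_closure_iff.1 hg' δ hδ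
  obtain ⟨n, c, w, hw⟩ := Submodule.mem_span_set'.1 hf
  choose v hv using fun i => (w i).2
  refine ⟨n, fun i => (v i).1, fun i => (v i).2, c, fun k => ?_⟩
  have h1 := (ContinuousMap.dist_le hδ.le).1 hd.le k
  rw [dist_comm, Real.dist_eq, ← hw] at h1
  convert h1 using 3
  rw [ContinuousMap.sum_apply]
  refine Finset.sum_congr rfl fun i _ => ?_
  rw [← hv i]
  rfl

theorem gg_l2 {X : Type*} [MeasurableSpace X] (μ : Measure X) (f : X → ℝ) (hf : MemLp f 2 μ)
    (e : ℝ) (he : 0 ≤ e) (h : eLpNorm f 2 μ ≤ ENNReal.ofReal e) : ∫ x, f x ^ 2 ∂μ ≤ e ^ 2 := by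
  rw [hf.eLpNorm_eq_integral_rpow_norm (by norm_num) (by norm_num),
    ENNReal.ofReal_le_ofReal_iff he] at h
  simp only [ENNReal.toReal_ofNat, Real.rpow_ofNat, Real.norm_eq_abs, sq_abs] at h
  have h0 : 0 ≤ ∫ x, f x ^ 2 ∂μ := integral_nonneg fun x => sq_nonneg _
  have h2 := pow_le_pow_left₀ (Real.rpow_nonneg h0 _) h 2
  rw [← Real.rpow_natCast, ← Real.rpow_mul h0] at h2
  norm_num at h2
  exact h2

theorem gg_uat {X Q : Type*} [Fintype Q] [MeasurableSpace X] (μ : Measure X) [IsProbabilityMeasure μ]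
    (hh : X → Set.Icc (0 : Q → ℝ) 1) (hemb : MeasurableEmbedding hh) (η : X → ℝ)
    (hη : Measurable η) (h0 : ∀ x, 0 ≤ η x) (h1 : ∀ x, η x ≤ 1) (ε : ℝ) (hε : 0 < ε) :
    ∃ (d : ℕ) (A : Matrix (Fin d) Q ℝ) (b a : Fin d → ℝ),
      ∫ x, (sigmoid ((∑ i, a i * sigmoid (A.mulVec (hh x).1 i + b i)) + 0) - η x) ^ 2 ∂μ ≤ ε := by
  set e : ℝ := min (1 / 4) (ε / 9) with he
  have e0 : 0 < e := lt_min (by norm_num) (by positivity)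
  have e1 : e ≤ 1 / 4 := min_le_left _ _
  have e2 : e ≤ ε / 9 := min_le_right _ _
  set y : X → ℝ := fun x => (1 - 2 * e) * η x + e with hy
  have y0 : ∀ x, e ≤ y x := fun x => by
    have := h0 x
    simp only [hy]; nlinarith
  have y1 : ∀ x, y x ≤ 1 - e := fun x => by
    have := h1 x
    simp only [hy]; nlinarith
  have ym : Measurable y := by fun_prop
  set τ : X → ℝ := fun x => Real.log (y x) - Real.log (1 - y x) with hτ
  have τm : Measurable τ := (Real.measurable_log.comp ym).sub
    (Real.measurable_log.comp (measurable_const.sub ym))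
  have τb : ∀ x, |τ x| ≤ -Real.log e := fun x => by
    have a1 := y0 x
    have a2 := y1 x
    have l1 := Real.log_le_log e0 a1
    have l2 := Real.log_le_log e0 (show e ≤ 1 - y x by linarith)
    have l3 := Real.log_nonpos (x := y x) (by linarith) (by linarith)
    have l4 := Real.log_nonpos (x := 1 - y x) (by linarith) (by linarith)
    rw [abs_le]; simp only [hτ]; constructor <;> linarith
  have τL : MemLp τ 2 μ := MemLp.of_bound τm.aestronglyMeasurable (-Real.log e)
    (Filter.Eventually.of_forall τb)
  obtain ⟨τ', τm', hτ'⟩ := hemb.exists_measurable_extend τm (fun _ => ⟨0⟩)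
  have hfin : IsProbabilityMeasure (μ.map hh) :=
    Measure.isProbabilityMeasure_map hemb.measurable.aemeasurable
  have τL' : MemLp τ' 2 (μ.map hh) := by
    rw [hemb.memLp_map_measure_iff, hτ']; exact τL
  obtain ⟨g, hg, gL⟩ := τL'.exists_boundedContinuous_eLpNorm_sub_le (by norm_num)
    (ε := ENNReal.ofReal e) (by simpa using e0)
  have hL : MemLp ((τ' - ⇑g) ∘ hh) 2 μ := hemb.memLp_map_measure_iff.1 (τL'.sub gL)
  rw [hemb.eLpNorm_map_measure] at hg
  have hI := gg_l2 μ _ hL e e0.le hg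
  have hInt : Integrable (fun x => (((τ' - ⇑g) ∘ hh) x) ^ 2) μ := hL.integrable_sq
  obtain ⟨d, A, b, a, hnet⟩ := gg_uat_unif g.toContinuousMap e e0
  refine ⟨d, A, b, a, ?_⟩
  have hpt : ∀ x, (sigmoid ((∑ i, a i * sigmoid (A.mulVec (hh x).1 i + b i)) + 0) - η x) ^ 2 ≤
      6 * e ^ 2 + 3 * (((τ' - ⇑g) ∘ hh) x) ^ 2 := by
    intro x
    rw [add_zero]
    have n1 := hnet (hh x)
    set net := ∑ i, a i * sigmoid (A.mulVec (hh x).1 i + b i)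
    have hc : τ' (hh x) = τ x := congrFun hτ' x
    have n2 := gg_sig_lip net (τ x)
    have n3 : sigmoid (τ x) = y x := gg_sig_logit _ (by linarith [y0 x]) (by linarith [y1 x])
    have n4 : |y x - η x| ≤ e := by
      have := h0 x
      have := h1 x
      rw [abs_le]; simp only [hy]; constructor <;> nlinarith
    have n5 : ((τ' - ⇑g) ∘ hh) x = τ x - g (hh x) := by simp [hc]
    rw [n5]
    have n1' : |net - g (hh x)| ≤ e := n1
    generalize g (hh x) = G at *
    rw [n3] at n2
    have n6 : |sigmoid net - η x| ≤ e + |τ x - G| + e := by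
      have t1 := abs_sub_le (sigmoid net) (y x) (η x)
      have t2 := abs_sub_le net G (τ x)
      rw [abs_sub_comm G] at t2
      linarith
    rw [← sq_abs, ← sq_abs (τ x - G)]
    have hn := abs_nonneg (sigmoid net - η x)
    have s1 := pow_le_pow_left₀ hn n6 2
    nlinarith [sq_nonneg (|τ x - G| - e)]
  have hmono : ∫ x, (sigmoid ((∑ i, a i * sigmoid (A.mulVec (hh x).1 i + b i)) + 0) - η x) ^ 2 ∂μ ≤
      ∫ x, (6 * e ^ 2 + 3 * (((τ' - ⇑g) ∘ hh) x) ^ 2) ∂μ :=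
    integral_mono_of_nonneg (Filter.Eventually.of_forall fun x => sq_nonneg _)
      ((integrable_const _).add (hInt.const_mul 3)) (Filter.Eventually.of_forall hpt)
  refine hmono.trans ?_
  rw [integral_add (integrable_const _) (hInt.const_mul 3), integral_const_mul 3]
  simp only [integral_const, probReal_univ, smul_eq_mul, one_mul]
  nlinarith

theorem gg_conv_cont (p : ℕ) (hp : 3 ≤ p) (k : Matrix (Fin 3) (Fin 3) ℝ)
    (i j : Fin (p - 3 + 1)) :
    Continuous fun x : Matrix (Fin p) (Fin p) ℝ => conv2d p p 3 hp hp k x i j := by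
  unfold conv2d
  exact continuous_finsetSum _ fun s _ => continuous_finsetSum _ fun t _ =>
    (Continuous.matrix_elem continuous_id _ _).mul continuous_const

theorem gg_conv_sub (p : ℕ) (hp : 3 ≤ p) (k : Matrix (Fin 3) (Fin 3) ℝ)
    (x y : Matrix (Fin p) (Fin p) ℝ) :
    conv2d p p 3 hp hp k (x - y) = conv2d p p 3 hp hp k x - conv2d p p 3 hp hp k y := by
  ext i j
  simp only [conv2d, Matrix.sub_apply, sub_mul, Finset.sum_sub_distrib]

instance ggBorel {p : ℕ} : BorelSpace (Matrix (Fin p) (Fin p) ℝ) :=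
  inferInstanceAs (BorelSpace (Fin p → Fin p → ℝ))

instance ggSB {p : ℕ} : StandardBorelSpace (Matrix (Fin p) (Fin p) ℝ) :=
  inferInstanceAs (StandardBorelSpace (Fin p → Fin p → ℝ))

theorem gg_cnn_cont {p d₀ d₁ : ℕ} (hp : 3 ≤ p)
    (ker : Fin d₀ → Matrix (Fin 3) (Fin 3) ℝ)
    (b₀ : Fin d₀ × Fin (p - 3 + 1) × Fin (p - 3 + 1) → ℝ)
    (A₁ : Matrix (Fin d₁) (Fin d₀ × Fin (p - 3 + 1) × Fin (p - 3 + 1)) ℝ)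
    (b₁ : Fin d₁ → ℝ) (a₂ : Fin d₁ → ℝ) (b₂ : ℝ) :
    Continuous fun x => cnnOut hp ker b₀ A₁ b₁ a₂ b₂ x := by
  unfold cnnOut
  refine (continuous_finsetSum _ fun i _ => continuous_const.mul
    (gg_sig_cont.comp (Continuous.add ?_ continuous_const))).add continuous_const
  simp only [Matrix.mulVec, dotProduct]
  exact continuous_finsetSum _ fun q _ => continuous_const.mul
    (gg_sig_cont.comp ((gg_conv_cont p hp _ _ _).add continuous_const))

theorem gg_go (p : ℕ) (hp : 3 ≤ p)
    (D : Measure (Matrix (Fin p) (Fin p) ℝ × Bool)) [IsProbabilityMeasure D] (ε : ℝ) (hε : 0 < ε) :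
    ∃ (d₁ : ℕ) (A₁ : Matrix (Fin d₁) (Fin 9 × Fin (p - 3 + 1) × Fin (p - 3 + 1)) ℝ)
      (b₁ a₂ : Fin d₁ → ℝ),
      ∫ z, cnnLoss hp (fun t => gaborKernel (ggTheta t) 1 1 (ggLam t) (ggPsi t))
        0 A₁ b₁ a₂ 0 z ∂D ≤ ggR D + ε := by
  set ker : Fin 9 → Matrix (Fin 3) (Fin 3) ℝ :=
    fun t => gaborKernel (ggTheta t) 1 1 (ggLam t) (ggPsi t) with hker
  set hh : Matrix (Fin p) (Fin p) ℝ →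
      Set.Icc (0 : Fin 9 × Fin (p - 3 + 1) × Fin (p - 3 + 1) → ℝ) 1 :=
    fun x => ⟨fun q => sigmoid (conv2d p p 3 hp hp (ker q.1) x q.2.1 q.2.2 + 0),
      fun q => gg_sig_nonneg _, fun q => gg_sig_le _⟩ with hhdef
  have hc : Continuous hh := by
    refine Continuous.subtype_mk (continuous_pi fun q => ?_) _
    exact gg_sig_cont.comp ((gg_conv_cont p hp _ _ _).add continuous_const)
  have hinj : Function.Injective hh := by
    intro x y hxy
    have h1 : ∀ q : Fin 9 × Fin (p - 3 + 1) × Fin (p - 3 + 1), sigmoid (conv2d p p 3 hp hp (ker q.1) x q.2.1 q.2.2 + 0) =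
        sigmoid (conv2d p p 3 hp hp (ker q.1) y q.2.1 q.2.2 + 0) :=
      fun q => congrFun (congrArg Subtype.val hxy) q
    rw [← sub_eq_zero]
    refine gg_wd p hp _ fun n => ?_
    rw [gg_conv_sub, sub_eq_zero]
    ext i j
    have := gg_sig_inj (h1 (n, i, j))
    simpa using this
  have hemb : MeasurableEmbedding hh := hc.measurable.measurableEmbedding hinj
  obtain ⟨d, A, b, a, h⟩ := gg_uat D.fst hh hemb (ggEta D) (ggEta_meas D) (ggEta_nonneg D)
    (ggEta_le D) ε hε
  refine ⟨d, A, b, a, ?_⟩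
  have hr := gg_risk D (fun x => sigmoid (cnnOut hp ker 0 A b a 0 x))
    (gg_sig_cont.comp (gg_cnn_cont hp ker 0 A b a 0)).measurable
    (fun x => gg_sig_nonneg _) (fun x => gg_sig_le _)
  have e1 : ∫ z, cnnLoss hp ker 0 A b a 0 z ∂D = _ := hr
  rw [e1]
  have h' : ∫ x, (sigmoid (cnnOut hp ker 0 A b a 0 x) - ggEta D x) ^ 2 ∂D.fst ≤ ε := h
  linarith

theorem gg_W_le {Z : Type*} {N : ℕ} (hN : 1 ≤ N) (L : Set (Z → ℝ))
    (hB : ∀ ℓ ∈ L, ∀ z, |ℓ z| ≤ 1) (S : Fin N → Z) (ℓ : Z → ℝ) (hℓ : ℓ ∈ L) :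
    ggW (fun i : L => i.1) S ≤ (∑ j, ℓ (S j)) + 2 * (N * empRad S L) := by
  have hNpos : (0 : ℝ) < N := by exact_mod_cast hN
  unfold ggW empRad
  have h1 : (⨅ i : L, ∑ j, i.1 (S j)) ≤ ∑ j, ℓ (S j) := by
    refine ciInf_le (f := fun i : L => ∑ j, i.1 (S j)) ⟨-(N : ℝ), ?_⟩ ⟨ℓ, hℓ⟩
    rintro _ ⟨i, rfl⟩
    have : ∑ j : Fin N, (-1 : ℝ) ≤ ∑ j, i.1 (S j) :=
      Finset.sum_le_sum fun j _ => (abs_le.1 (hB i.1 i.2 (S j))).1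
    simpa using this
  have h2 : (N : ℝ) * ((2 ^ N : ℝ)⁻¹ * ∑ ε : Fin N → Bool,
      sSup ((fun h : Z → ℝ =>
        (N : ℝ)⁻¹ * ∑ i : Fin N, (if ε i then (1 : ℝ) else -1) * h (S i)) '' L)) =
      (2 ^ N : ℝ)⁻¹ * ∑ ε : Fin N → Bool,
        ⨆ i : L, ∑ j, (if ε j then (1 : ℝ) else -1) * i.1 (S j) := by
    rw [mul_left_comm, Finset.mul_sum]
    congr 1
    refine Finset.sum_congr rfl fun ε _ => ?_
    rw [sSup_image', ← Real.mul_iSup_of_nonneg (by positivity), ← mul_assoc,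
      mul_inv_cancel₀ hNpos.ne', one_mul]
  rw [h2]
  linarith

/-- **Corollary 2.** Let `L` be a countable class of loss functions of common CNNs with
a fixed architecture. With probability at least `1 - δ` over an i.i.d. sample `S` of
size `N` from `D`, for every common CNN `F` in the class and every `ε > 0`, some
well-defined GO-CNN `G` whose first-layer kernels are Gabor kernels and whose first
fully-connected layer has width `d₁ ≥ d*` satisfies
`E_D[ℓ_G] ≤ Ê_S[F] + 2 Ř_S(L) + √(log(1/δ)/(2N)) + ε`. -/
theorem gaborGoCNN_generalization_bound
    (p : ℕ) (hp : 3 ≤ p)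
    (D : Measure (Matrix (Fin p) (Fin p) ℝ × Bool)) [IsProbabilityMeasure D]
    (N : ℕ) (hN : 1 ≤ N)
    -- fixed architecture of the common CNNs
    (d₀F d₁F : ℕ)
    -- the countable class `L` of loss functions of common CNNs
    (L : Set ((Matrix (Fin p) (Fin p) ℝ × Bool) → ℝ))
    (hLne : L.Nonempty) (hLct : L.Countable)
    (hLcnn : ∀ ℓ ∈ L,
      ∃ (kerF : Fin d₀F → Matrix (Fin 3) (Fin 3) ℝ)
        (b₀F : Fin d₀F × Fin (p - 3 + 1) × Fin (p - 3 + 1) → ℝ)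
        (A₁F : Matrix (Fin d₁F) (Fin d₀F × Fin (p - 3 + 1) × Fin (p - 3 + 1)) ℝ)
        (b₁F a₂F : Fin d₁F → ℝ) (b₂F : ℝ),
        ℓ = cnnLoss hp kerF b₀F A₁F b₁F a₂F b₂F)
    (δ : ℝ) (hδ : δ ∈ Set.Ioo (0 : ℝ) 1) :
    ENNReal.ofReal (1 - δ) ≤
      (Measure.pi fun _ : Fin N => D)
        {S : Fin N → Matrix (Fin p) (Fin p) ℝ × Bool |
          ∀ ℓF ∈ L, ∀ ε : ℝ, 0 < ε →
            ∃ (dstar d₁ : ℕ), dstar ≤ d₁ ∧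
              ∃ (od : ℕ) (θ σ γ lam ψ : Fin od → ℝ)
                (b₀G : Fin od × Fin (p - 3 + 1) × Fin (p - 3 + 1) → ℝ)
                (A₁G : Matrix (Fin d₁) (Fin od × Fin (p - 3 + 1) × Fin (p - 3 + 1)) ℝ)
                (b₁G a₂G : Fin d₁ → ℝ) (b₂G : ℝ),
                -- `G` is well defined
                (∀ x : Matrix (Fin p) (Fin p) ℝ,
                  (∀ t : Fin od,
                    conv2d p p 3 hp hp
                      (gaborKernel (θ t) (σ t) (γ t) (lam t) (ψ t)) x = 0) → x = 0) ∧
                -- `E_D[ℓ_G] ≤ Ê_S[F] + 2 Ř_S(L) + √(log(1/δ)/(2N)) + ε`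
                ∫ z, cnnLoss hp
                    (fun t => gaborKernel (θ t) (σ t) (γ t) (lam t) (ψ t))
                    b₀G A₁G b₁G a₂G b₂G z ∂D ≤
                  (N : ℝ)⁻¹ * ∑ i : Fin N, ℓF (S i) + 2 * empRad S L +
                    Real.sqrt (Real.log (1 / δ) / (2 * N)) + ε} := by
  choose kerF b₀F A₁F b₁F a₂F b₂F hF using hLcnn
  have hct : Countable L := hLct.to_subtype
  have hne : Nonempty L := hLne.to_subtype
  set f : L → Matrix (Fin p) (Fin p) ℝ → ℝ := fun i x =>
    sigmoid (cnnOut hp (kerF i.1 i.2) (b₀F i.1 i.2) (A₁F i.1 i.2) (b₁F i.1 i.2) (a₂F i.1 i.2)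
      (b₂F i.1 i.2) x) with hf
  have hk : (fun (i : L) (z : Matrix (Fin p) (Fin p) ℝ × Bool) =>
      (f i z.1 - (if z.2 then (1 : ℝ) else 0)) ^ 2) = fun i : L => i.1 := by
    funext i z
    conv_rhs => rw [hF i.1 i.2]
    rfl
  have hB : ∀ ℓ ∈ L, ∀ z, |ℓ z| ≤ 1 := by
    intro ℓ hℓ z
    have h1 := gg_loss_bd (f ⟨ℓ, hℓ⟩) (fun x => gg_sig_nonneg _) (fun x => gg_sig_le _) z
    have h2 := congrFun (congrFun hk ⟨ℓ, hℓ⟩) z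
    simp only at h2
    rw [h2] at h1
    rw [abs_of_nonneg h1.1]; exact h1.2
  have hconc := gg_conc D N hN f
    (fun i => (gg_sig_cont.comp (gg_cnn_cont hp _ _ _ _ _ _)).measurable)
    (fun i x => gg_sig_nonneg _) (fun i x => gg_sig_le _) δ hδ
  rw [hk] at hconc
  refine hconc.trans (measure_mono ?_)
  intro S hS ℓF hℓF ε hε
  have hS' : N * ggR D ≤ ggW (fun i : L => i.1) S + N * Real.sqrt (Real.log (1 / δ) / (2 * N)) := hS
  obtain ⟨d₁, A, b, a, h⟩ := gg_go p hp D ε hε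
  refine ⟨0, d₁, Nat.zero_le _, 9, ggTheta, fun _ => 1, fun _ => 1, ggLam, ggPsi, 0, A, b, a, 0,
    gg_wd p hp, h.trans ?_⟩
  have hW := gg_W_le hN L hB S ℓF hℓF
  have hNpos : (0 : ℝ) < N := by exact_mod_cast hN
  have hfin : ggR D ≤ (N : ℝ)⁻¹ * ∑ i : Fin N, ℓF (S i) + 2 * empRad S L +
      Real.sqrt (Real.log (1 / δ) / (2 * N)) := by
    refine le_of_mul_le_mul_left ?_ hNpos
    have e1 : (N : ℝ) * ((N : ℝ)⁻¹ * ∑ i : Fin N, ℓF (S i) + 2 * empRad S L +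
      Real.sqrt (Real.log (1 / δ) / (2 * N))) = (∑ i : Fin N, ℓF (S i)) + 2 * (N * empRad S L) +
      N * Real.sqrt (Real.log (1 / δ) / (2 * N)) := by
      rw [mul_add, mul_add, ← mul_assoc, mul_inv_cancel₀ hNpos.ne']; ring
    rw [e1]; linarith
  linarith
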